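/- Fix an integer ν ≥ 1. There exists a constant C = C(ν) > 0 such that for every ε > 0 there exists T₀ with the following property: for every real T ≥ T₀, for all but at most ε·π(T) primes p ≤ T, for every integer h with 3 ≤ h < T and every s ∈ F_p, the set A = {x + s : 1 ≤ x ≤ h} ⊆ F_p satisfies #A^{(ν)} ≥ min(h^ν, (hT)^{1/2})·exp(−C·log h/log log h), where A^{(ν)} = {a_1⋯a_ν : a_1,…,a_ν ∈ A}. -/

import Mathlib

lemma succ_le_rpow_mul_of_two_le {δ : ℝ} (hδ : 0 < δ) (a p : ℕ) (hp : 2 ≤ p) :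
    (a : ℝ) + 1 ≤ ((p : ℝ) ^ a) ^ δ * Real.exp (1 / (δ * Real.log 2)) := by
  have hp0 : (0 : ℝ) < p := by positivity
  have h2 : 0 < Real.log 2 := Real.log_pos (by norm_num)
  have hδ2 : 0 < δ * Real.log 2 := by positivity
  have hlog : Real.log 2 ≤ Real.log p := Real.log_le_log (by norm_num) (by exact_mod_cast hp)
  have h1 : 1 + a * (δ * Real.log 2) ≤ ((p : ℝ) ^ a) ^ δ := by
    rw [Real.rpow_def_of_pos (by positivity), Real.log_pow]
    have := Real.add_one_le_exp (a * Real.log p * δ)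
    have h3 : a * (δ * Real.log 2) ≤ a * Real.log p * δ := by
      have : a * δ * Real.log 2 ≤ a * δ * Real.log p := by gcongr
      linarith
    linarith
  have h4 : 1 + 1 / (δ * Real.log 2) ≤ Real.exp (1 / (δ * Real.log 2)) := by
    have := Real.add_one_le_exp (1 / (δ * Real.log 2))
    linarith
  calc (a : ℝ) + 1 ≤ (1 + a * (δ * Real.log 2)) * (1 + 1 / (δ * Real.log 2)) := by
        have : (1 + a * (δ * Real.log 2)) * (1 + 1 / (δ * Real.log 2))
          = a + 1 + a * (δ * Real.log 2) + 1 / (δ * Real.log 2) := by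
          field_simp
          ring
        rw [this]
        have : 0 ≤ a * (δ * Real.log 2) := by positivity
        have : 0 ≤ 1 / (δ * Real.log 2) := by positivity
        linarith
    _ ≤ _ := by gcongr

lemma succ_le_rpow_of_large {δ : ℝ} (a p : ℕ) (hp : 2 ≤ p)
    (hlarge : Real.log 2 ≤ δ * Real.log p) :
    (a : ℝ) + 1 ≤ ((p : ℝ) ^ a) ^ δ := by
  have hp0 : (0 : ℝ) < p := by positivity
  rw [Real.rpow_def_of_pos (by positivity), Real.log_pow]
  have h2 : (a : ℝ) + 1 ≤ 2 ^ a := by exact_mod_cast Nat.lt_two_pow_self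
  calc (a : ℝ) + 1 ≤ 2 ^ a := h2
    _ = Real.exp (a * Real.log 2) := by
        rw [← Real.log_pow, Real.exp_log (by positivity)]
    _ ≤ _ := by
        apply Real.exp_le_exp.2
        have : a * Real.log 2 ≤ a * (δ * Real.log p) := by gcongr
        linarith

lemma card_divisors_le_rpow_mul_exp {δ : ℝ} (hδ : 0 < δ) {n : ℕ} (hn : n ≠ 0) :
    (n.divisors.card : ℝ) ≤
      (n : ℝ) ^ δ * Real.exp (Real.exp (Real.log 2 / δ) * (1 / (δ * Real.log 2))) := by
  have h2 : 0 < Real.log 2 := Real.log_pos (by norm_num)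
  set W := Real.exp (1 / (δ * Real.log 2))
  have hW : 1 ≤ W := Real.one_le_exp (by positivity)
  set y := Real.exp (Real.log 2 / δ)
  rw [Nat.card_divisors hn]
  push_cast
  have key : ∀ p ∈ n.primeFactors, ((n.factorization p : ℕ) : ℝ) + 1 ≤
      ((p : ℝ) ^ n.factorization p) ^ δ * (if (p : ℝ) ≤ y then W else 1) := by
    intro p hp
    have hp2 := (Nat.prime_of_mem_primeFactors hp).two_le
    split_ifs with h
    · exact succ_le_rpow_mul_of_two_le hδ _ p hp2
    · rw [mul_one]
      apply succ_le_rpow_of_large _ p hp2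
      have : Real.log 2 / δ ≤ Real.log p := by
        rw [Real.le_log_iff_exp_le (by positivity)]
        exact (not_le.1 h).le
      rw [div_le_iff₀ hδ] at this
      linarith
  refine (Finset.prod_le_prod (fun _ _ => by positivity) key).trans ?_
  rw [Finset.prod_mul_distrib, Real.finsetProd_rpow _ _ (fun _ _ => by positivity)]
  have hprod : ∏ p ∈ n.primeFactors, (p : ℝ) ^ n.factorization p = n := by
    have := Nat.prod_factorization_pow_eq_self hn
    rw [Finsupp.prod, Nat.support_factorization] at this
    exact_mod_cast this
  rw [hprod]
  gcongr
  rw [Finset.prod_ite, Finset.prod_const, Finset.prod_const_one, mul_one, ← Real.exp_nat_mul]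
  gcongr
  have hcard : (n.primeFactors.filter (fun p : ℕ => (p : ℝ) ≤ y)) ⊆ Finset.Icc 1 ⌊y⌋₊ := by
    intro p hp
    rw [Finset.mem_filter] at hp
    exact Finset.mem_Icc.2 ⟨(Nat.prime_of_mem_primeFactors hp.1).one_le, Nat.le_floor hp.2⟩
  have := Finset.card_le_card hcard
  rw [Nat.card_Icc, Nat.add_sub_cancel] at this
  exact (Nat.cast_le.2 this).trans (Nat.floor_le (Real.exp_pos _).le)

lemma exists_card_divisors_le (K : ℝ) (hK : 0 ≤ K) : ∃ C : ℝ, 0 < C ∧ ∀ H : ℝ, 16 ≤ H → ∀ n : ℕ,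
    n ≠ 0 → (n : ℝ) ≤ H ^ K →
      (n.divisors.card : ℝ) ≤ Real.exp (C * (Real.log H / Real.log (Real.log H))) := by
  have h2 : 0 < Real.log 2 := Real.log_pos (by norm_num)
  refine ⟨2 * Real.log 2 * K + 8 / Real.log 2 ^ 2, by positivity, fun H hH n hn hnH => ?_⟩
  set L := Real.log H with hL
  set l := Real.log L with hl
  have hL1 : 1 < L := by
    rw [hL, Real.lt_log_iff_exp_lt (by linarith)]
    have := Real.exp_one_lt_d9
    linarith
  have hl0 : 0 < l := Real.log_pos hL1
  set δ := 2 * Real.log 2 / l with hδ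
  have hδ0 : 0 < δ := by positivity
  refine (card_divisors_le_rpow_mul_exp hδ0 hn).trans ?_
  have e1 : Real.log 2 / δ = l / 2 := by rw [hδ]; field_simp
  have e2 : 1 / (δ * Real.log 2) = l / (2 * Real.log 2 ^ 2) := by rw [hδ]; field_simp
  rw [e1, e2]
  have h3 : (n : ℝ) ^ δ ≤ Real.exp (2 * Real.log 2 * K * (L / l)) := by
    calc (n : ℝ) ^ δ ≤ (H ^ K) ^ δ := by gcongr
      _ = Real.exp (2 * Real.log 2 * K * (L / l)) := by
        rw [← Real.rpow_mul (by linarith), Real.rpow_def_of_pos (by linarith), hδ]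
        congr 1
        ring
  have h4 : l ^ 2 ≤ 16 * Real.exp (l / 2) := by
    have := Real.add_one_le_exp (l / 4)
    have e : Real.exp (l / 2) = Real.exp (l / 4) ^ 2 := by
      rw [← Real.exp_nat_mul]; congr 1; push_cast; ring
    rw [e]
    nlinarith
  have h5 : Real.exp (l / 2) * Real.exp (l / 2) = L := by
    rw [← Real.exp_add, add_halves, hl, Real.exp_log (by linarith)]
  have h6 : Real.exp (l / 2) * (l / (2 * Real.log 2 ^ 2)) ≤ 8 / Real.log 2 ^ 2 * (L / l) := by
    have : Real.exp (l / 2) * l ≤ 16 * (L / l) := by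
      rw [← h5, ← mul_div_assoc, le_div_iff₀ hl0]
      nlinarith [Real.exp_pos (l / 2)]
    calc _ = (Real.exp (l / 2) * l) * (1 / (2 * Real.log 2 ^ 2)) := by ring
      _ ≤ (16 * (L / l)) * (1 / (2 * Real.log 2 ^ 2)) := by gcongr
      _ = _ := by ring
  calc _ ≤ Real.exp (2 * Real.log 2 * K * (L / l)) * Real.exp (8 / Real.log 2 ^ 2 * (L / l)) := by
        gcongr
    _ = _ := by rw [← Real.exp_add]; congr 1; ring

section
open Polynomial

/-- The polynomial `∏ (X + x i)`. -/
noncomputable def shiftPoly {k : ℕ} (x : Fin k → ℕ) : ℤ[X] := ∏ i, (X + C (x i : ℤ))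

/-- The polynomial `∏ (X + x i) - ∏ (X + y i)`. -/
noncomputable def diffPoly {k : ℕ} (x y : Fin k → ℕ) : ℤ[X] := shiftPoly x - shiftPoly y

lemma natDegree_shiftPoly {k : ℕ} (x : Fin k → ℕ) : (shiftPoly x).natDegree = k := by
  rw [shiftPoly, natDegree_prod_of_monic _ _ (fun i _ => monic_X_add_C _)]
  simp only [natDegree_X_add_C, Finset.sum_const, Finset.card_univ, Fintype.card_fin, smul_eq_mul,
    mul_one]

lemma natDegree_diffPoly_le {k : ℕ} (x y : Fin k → ℕ) : (diffPoly x y).natDegree ≤ k := by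
  refine (natDegree_sub_le _ _).trans ?_
  simp [natDegree_shiftPoly]

lemma coeff_prod_X_add_C_mem {ι : Type*} (s : Finset ι) (x : ι → ℕ) {N : ℕ} (hx : ∀ i, x i ≤ N)
    (n : ℕ) : 0 ≤ (∏ i ∈ s, (X + C (x i : ℤ))).coeff n ∧
      (∏ i ∈ s, (X + C (x i : ℤ))).coeff n ≤ ((N : ℤ) + 1) ^ s.card := by
  classical
  induction s using Finset.induction_on generalizing n with
  | empty =>
    rw [Finset.prod_empty, coeff_one]
    split_ifs <;> simp
  | insert a s ha ih =>
    rw [Finset.prod_insert ha, Finset.card_insert_of_notMem ha, add_mul, coeff_add, coeff_C_mul,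
      pow_succ]
    have hxa : (x a : ℤ) ≤ N := by exact_mod_cast hx a
    have hxa0 : (0 : ℤ) ≤ x a := by positivity
    have h1 := ih n
    have hp : (0 : ℤ) ≤ ((N : ℤ) + 1) ^ s.card := by positivity
    have h2 : (x a : ℤ) * (∏ i ∈ s, (X + C (x i : ℤ))).coeff n ≤ N * ((N : ℤ) + 1) ^ s.card :=
      mul_le_mul hxa h1.2 h1.1 (by positivity)
    have h3 : (0 : ℤ) ≤ (x a : ℤ) * (∏ i ∈ s, (X + C (x i : ℤ))).coeff n := mul_nonneg hxa0 h1.1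
    rcases n with _ | n
    · rw [mul_coeff_zero, coeff_X_zero, zero_mul, zero_add]
      exact ⟨h3, by linarith⟩
    · rw [coeff_X_mul]
      have h4 := ih n
      exact ⟨by linarith, by linarith⟩

lemma abs_coeff_diffPoly_le {k N : ℕ} {x y : Fin k → ℕ} (hx : ∀ i, x i ≤ N) (hy : ∀ i, y i ≤ N)
    (n : ℕ) : |(diffPoly x y).coeff n| ≤ ((N : ℤ) + 1) ^ k := by
  have h1 := coeff_prod_X_add_C_mem Finset.univ x hx n
  have h2 := coeff_prod_X_add_C_mem Finset.univ y hy n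
  rw [Finset.card_univ, Fintype.card_fin] at h1 h2
  rw [diffPoly, coeff_sub, shiftPoly, shiftPoly, abs_le]
  constructor <;> linarith

lemma eval_neg_diffPoly {k : ℕ} (x y : Fin k → ℕ) (i : Fin k) :
    (diffPoly x y).eval (-(y i : ℤ)) = ∏ j, ((x j : ℤ) - y i) := by
  rw [diffPoly, shiftPoly, shiftPoly, eval_sub, eval_prod, eval_prod]
  have : ∏ j, (X + C (y j : ℤ)).eval (-(y i : ℤ)) = 0 :=
    Finset.prod_eq_zero (Finset.mem_univ i) (by rw [eval_add, eval_X, eval_C, neg_add_cancel])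
  rw [this, sub_zero]
  refine Finset.prod_congr rfl fun j _ => ?_
  rw [eval_add, eval_X, eval_C]
  ring

lemma eval_neg_diffPoly_ne_zero {k : ℕ} {x y : Fin k → ℕ} (h : ∀ i j, x i ≠ y j) (i : Fin k) :
    (diffPoly x y).eval (-(y i : ℤ)) ≠ 0 := by
  rw [eval_neg_diffPoly, Finset.prod_ne_zero_iff]
  intro j _
  rw [sub_ne_zero]
  exact_mod_cast h j i

lemma diffPoly_ne_zero {k : ℕ} (hk : 1 ≤ k) {x y : Fin k → ℕ} (h : ∀ i j, x i ≠ y j) :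
    diffPoly x y ≠ 0 := by
  intro h0
  apply eval_neg_diffPoly_ne_zero h ⟨0, hk⟩
  rw [h0, eval_zero]

lemma abs_coeff_le_of_dvd {P f : ℤ[X]} (hP : P ≠ 0) (hf : f ∣ P) {k : ℕ} (hk : P.natDegree ≤ k)
    {B : ℤ} (hB : ∀ n, |P.coeff n| ≤ B) (n : ℕ) : |f.coeff n| ≤ 2 ^ k * ((k + 1) * B) := by
  obtain ⟨g, rfl⟩ := hf
  have hg : g ≠ 0 := right_ne_zero_of_mul hP
  have hf : f ≠ 0 := left_ne_zero_of_mul hP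
  have hB0 : 0 ≤ B := (abs_nonneg _).trans (hB 0)
  have h1 := norm_coeff_le_choose_mul_mahlerMeasure_of_one_le_mahlerMeasure n
    (f.map (Int.castRingHom ℂ)) (g.map (Int.castRingHom ℂ)) (one_le_mahlerMeasure_of_ne_zero hg)
  rw [← Polynomial.map_mul] at h1
  have h2 := mahlerMeasure_le_sum_norm_coeff ((f * g).map (Int.castRingHom ℂ))
  have hdeg : ((f * g).map (Int.castRingHom ℂ)).natDegree < k + 1 :=
    Nat.lt_succ_of_le (natDegree_map_le.trans hk)
  rw [sum_over_range' _ (fun _ => norm_zero) _ hdeg] at h2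
  have h3 : ∑ a ∈ Finset.range (k + 1), ‖((f * g).map (Int.castRingHom ℂ)).coeff a‖ ≤
      ∑ a ∈ Finset.range (k + 1), (B : ℝ) := by
    refine Finset.sum_le_sum fun i _ => ?_
    rw [coeff_map, eq_intCast, Complex.norm_intCast]
    exact_mod_cast hB i
  rw [Finset.sum_const, Finset.card_range, nsmul_eq_mul] at h3
  rw [coeff_map, eq_intCast, Complex.norm_intCast] at h1
  have h4 : ((f.map (Int.castRingHom ℂ)).natDegree.choose n : ℝ) ≤ 2 ^ k := by
    have hd : (f.map (Int.castRingHom ℂ)).natDegree ≤ k := by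
      refine natDegree_map_le.trans (le_trans ?_ hk)
      rw [natDegree_mul hf hg]
      exact Nat.le_add_right _ _
    exact_mod_cast (Nat.choose_le_two_pow _ _).trans (Nat.pow_le_pow_right (by norm_num) hd)
  have h5 : |(f.coeff n : ℝ)| ≤ 2 ^ k * ((k + 1) * B) := by
    refine h1.trans (mul_le_mul h4 (h2.trans ?_) (mahlerMeasure_nonneg _) (by positivity))
    exact_mod_cast h3
  exact_mod_cast h5

lemma abs_eval_le {f : ℤ[X]} {k : ℕ} (hk : f.natDegree ≤ k) {B : ℤ} (hB : ∀ n, |f.coeff n| ≤ B)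
    {N : ℕ} (hN : 1 ≤ N) {a : ℤ} (ha : |a| ≤ N) : |f.eval a| ≤ (k + 1) * (B * N ^ k) := by
  have hB0 : 0 ≤ B := (abs_nonneg _).trans (hB 0)
  rw [eval_eq_sum_range' (Nat.lt_succ_of_le hk)]
  refine (Finset.abs_sum_le_sum_abs _ _).trans ?_
  have : ∀ i ∈ Finset.range (k + 1), |f.coeff i * a ^ i| ≤ B * (N : ℤ) ^ k := by
    intro i hi
    rw [abs_mul, abs_pow]
    have hi' : i ≤ k := Nat.lt_succ_iff.1 (Finset.mem_range.1 hi)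
    refine mul_le_mul (hB i) ?_ (by positivity) hB0
    exact (pow_le_pow_left₀ (abs_nonneg _) ha i).trans
      (pow_le_pow_right₀ (by exact_mod_cast hN) hi')
  refine (Finset.sum_le_sum this).trans ?_
  rw [Finset.sum_const, Finset.card_range, nsmul_eq_mul]
  push_cast
  rfl

lemma abs_eval_le_pow_of_dvd_diffPoly {k N : ℕ} (hk : 1 ≤ k) (hN : 2 ≤ N) {x y : Fin k → ℕ}
    (hx : ∀ i, x i ≤ N) (hy : ∀ i, y i ≤ N) (h : ∀ i j, x i ≠ y j) {f : ℤ[X]}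
    (hf : f ∣ diffPoly x y) {a : ℤ} (ha : |a| ≤ N) : |f.eval a| ≤ (N : ℤ) ^ (6 * k) := by
  have hD := diffPoly_ne_zero hk h
  have h1 := abs_coeff_le_of_dvd hD hf (natDegree_diffPoly_le x y) (abs_coeff_diffPoly_le hx hy)
  have h2 := abs_eval_le ((natDegree_le_of_dvd hf hD).trans (natDegree_diffPoly_le x y)) h1
    (by omega) ha
  refine h2.trans ?_
  have e1 : (k : ℤ) + 1 ≤ N ^ k := by
    have : k + 1 ≤ 2 ^ k := Nat.lt_two_pow_self
    exact_mod_cast this.trans (Nat.pow_le_pow_left hN k)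
  have e2 : (2 : ℤ) ^ k ≤ N ^ k := by exact_mod_cast Nat.pow_le_pow_left hN k
  have e3 : ((N : ℤ) + 1) ^ k ≤ (N ^ 2) ^ k := by
    apply pow_le_pow_left₀ (by positivity)
    have : (2 : ℤ) ≤ N := by exact_mod_cast hN
    nlinarith
  calc ((k : ℤ) + 1) * (2 ^ k * ((k + 1) * ((N : ℤ) + 1) ^ k) * N ^ k)
      ≤ N ^ k * (N ^ k * (N ^ k * (N ^ 2) ^ k) * N ^ k) := by gcongr
    _ = _ := by ring

lemma prod_eval_neg_eq_of_dvd_diffPoly {k : ℕ} {x y : Fin k → ℕ} {f : ℤ[X]}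
    (hD : diffPoly x y ≠ 0) (hf : f ∣ diffPoly x y) :
    ∏ i, f.eval (-(x i : ℤ)) = ∏ i, f.eval (-(y i : ℤ)) := by
  obtain ⟨g, hg⟩ := hf
  have hne : f * g ≠ 0 := hg ▸ hD
  have key : ∀ z : Fin k → ℕ, f.resultant (shiftPoly z) f.natDegree k =
      ((-1) ^ f.natDegree) ^ k * ∏ i, f.eval (-(z i : ℤ)) := by
    intro z
    have := resultant_prod_right Finset.univ f (fun i => X + C (z i : ℤ)) f.natDegree le_rfl
      (by simp only [leadingCoeff_X_add_C, Finset.prod_const_one]; exact one_ne_zero)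
    rw [← shiftPoly, natDegree_shiftPoly] at this
    rw [this]
    have h2 : ∀ i, f.resultant (X + C (z i : ℤ)) = (-1) ^ f.natDegree * f.eval (-(z i : ℤ)) := by
      intro i
      rw [natDegree_X_add_C, resultant_X_add_C_right _ _ _ le_rfl]
    simp_rw [h2]
    rw [Finset.prod_mul_distrib, Finset.prod_const, Finset.card_univ, Fintype.card_fin]
  have hxy : shiftPoly x = shiftPoly y + f * g := by rw [← hg, diffPoly]; ring
  have hdeg : g.natDegree + f.natDegree ≤ k := by
    rw [add_comm, ← natDegree_mul (left_ne_zero_of_mul hne) (right_ne_zero_of_mul hne), ← hg]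
    exact natDegree_diffPoly_le x y
  have h3 := key x
  rw [hxy, resultant_add_mul_right _ _ _ _ _ hdeg le_rfl, key y] at h3
  exact (mul_left_cancel₀ (by simp) h3).symm

lemma one_le_log_div_log_log {H : ℝ} (hH : 16 ≤ H) :
    1 ≤ Real.log H / Real.log (Real.log H) := by
  have hL1 : 1 < Real.log H := by
    rw [Real.lt_log_iff_exp_lt (by linarith)]
    have := Real.exp_one_lt_d9
    linarith
  rw [one_le_div (Real.log_pos hL1)]
  exact (Real.log_le_sub_one_of_pos (by linarith)).trans (by linarith)

/-- The tuples in `{1, …, N} ^ k`. -/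
def box (k N : ℕ) : Finset (Fin k → ℕ) := Fintype.piFinset fun _ => Finset.Icc 1 N

lemma mem_box {k N : ℕ} {x : Fin k → ℕ} : x ∈ box k N ↔ ∀ i, 1 ≤ x i ∧ x i ≤ N := by
  simp [box, Fintype.mem_piFinset]

lemma card_box (k N : ℕ) : (box k N).card = N ^ k := by
  simp [box, Fintype.card_piFinset]

/-- The pairs of tuples in `{1, …, N} ^ k` with no common entry. -/
def disjointPairs (k N : ℕ) : Finset ((Fin k → ℕ) × (Fin k → ℕ)) :=
  (box k N ×ˢ box k N).filter fun u => ∀ i j, u.1 i ≠ u.2 j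

lemma mem_disjointPairs {k N : ℕ} {u : (Fin k → ℕ) × (Fin k → ℕ)} :
    u ∈ disjointPairs k N ↔
      ((∀ i, 1 ≤ u.1 i ∧ u.1 i ≤ N) ∧ ∀ i, 1 ≤ u.2 i ∧ u.2 i ≤ N) ∧ ∀ i j, u.1 i ≠ u.2 j := by
  rw [disjointPairs, Finset.mem_filter, Finset.mem_product, mem_box, mem_box]

section
open scoped Classical

lemma card_filter_eval_neg_eq_le {f : ℤ[X]} (hf : 0 < f.natDegree) (s : Finset ℕ) (v : ℤ) :
    (s.filter fun n : ℕ => f.eval (-(n : ℤ)) = v).card ≤ f.natDegree := by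
  have hne : f - C v ≠ 0 := by
    intro h
    rw [sub_eq_zero] at h
    rw [h, natDegree_C] at hf
    exact hf.false
  have h1 : (s.filter fun n : ℕ => f.eval (-(n : ℤ)) = v).card ≤ (f - C v).roots.toFinset.card := by
    refine Finset.card_le_card_of_injOn (fun n : ℕ => -(n : ℤ)) ?_ ?_
    · intro n hn
      simp only [Finset.coe_filter, Set.mem_ofPred_eq] at hn
      rw [Finset.mem_coe, Multiset.mem_toFinset, mem_roots hne, IsRoot, eval_sub, eval_C, hn.2,
        sub_self]
    · intro a _ b _ h
      simpa using h
  refine h1.trans ((Multiset.toFinset_card_le _).trans ((card_roots' _).trans ?_))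
  rw [natDegree_sub_C]

lemma card_filter_eval_neg_dvd_le {f : ℤ[X]} (hf : 0 < f.natDegree) (s : Finset ℕ) {M : ℤ}
    (hM : M ≠ 0) :
    (s.filter fun n : ℕ => f.eval (-(n : ℤ)) ∣ M).card ≤
      2 * f.natDegree * M.natAbs.divisors.card := by
  refine Finset.card_le_mul_card_image_of_maps_to (f := fun n : ℕ => (f.eval (-(n : ℤ))).natAbs)
    ?_ _ ?_
  · intro n hn
    rw [Finset.mem_filter] at hn
    rw [Nat.mem_divisors]
    exact ⟨Int.natAbs_dvd_natAbs.2 hn.2, Int.natAbs_ne_zero.2 hM⟩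
  · intro v _
    have hsub : ((s.filter fun n : ℕ => f.eval (-(n : ℤ)) ∣ M).filter
        fun n : ℕ => (f.eval (-(n : ℤ))).natAbs = v) ⊆
        (s.filter fun n : ℕ => f.eval (-(n : ℤ)) = v) ∪
          (s.filter fun n : ℕ => f.eval (-(n : ℤ)) = -v) := by
      intro n hn
      simp only [Finset.mem_filter, Finset.mem_union] at hn ⊢
      have := Int.natAbs_eq (f.eval (-(n : ℤ)))
      rw [hn.2] at this
      rcases this with h | h
      · exact Or.inl ⟨hn.1.1, h⟩
      · exact Or.inr ⟨hn.1.1, h⟩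
    refine (Finset.card_le_card hsub).trans ((Finset.card_union_le _ _).trans ?_)
    have h1 := card_filter_eval_neg_eq_le hf s v
    have h2 := card_filter_eval_neg_eq_le hf s (-v)
    omega

lemma exists_card_dvd_diffPoly_le {k : ℕ} (hk : 1 ≤ k) : ∃ A : ℝ, 0 < A ∧ ∀ N : ℕ, 16 ≤ N →
    ∀ f : ℤ[X], 0 < f.natDegree →
      (((disjointPairs k N).filter fun u => f ∣ diffPoly u.1 u.2).card : ℝ) ≤
        (N : ℝ) ^ k * Real.exp (A * (Real.log N / Real.log (Real.log N))) := by
  obtain ⟨A, hA, hdiv⟩ := exists_card_divisors_le ((6 * k * k : ℕ) : ℝ) (by positivity)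
  refine ⟨k * A + 2 * k * k, by positivity, fun N hN f hf => ?_⟩
  have hN' : (16 : ℝ) ≤ N := by exact_mod_cast hN
  set g := Real.log N / Real.log (Real.log N)
  have hg : 1 ≤ g := one_le_log_div_log_log hN'
  set S := (disjointPairs k N).filter fun u => f ∣ diffPoly u.1 u.2
  have hfib : ∀ y ∈ box k N, ((S.filter fun u => u.2 = y).card : ℝ) ≤
      Real.exp ((k * A + 2 * k * k) * g) := by
    intro y _
    rcases (S.filter fun u => u.2 = y).eq_empty_or_nonempty with h0 | ⟨u₀, hu₀⟩
    · rw [h0, Finset.card_empty, Nat.cast_zero]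
      positivity
    simp only [S, Finset.mem_filter, mem_disjointPairs] at hu₀
    obtain ⟨⟨⟨⟨hx0, hy0⟩, hdis⟩, hdvd⟩, rfl⟩ := hu₀
    have hD := diffPoly_ne_zero hk hdis
    have hdeg : f.natDegree ≤ k := (natDegree_le_of_dvd hdvd hD).trans (natDegree_diffPoly_le _ _)
    set M := ∏ i, f.eval (-(u₀.2 i : ℤ)) with hMdef
    have hM : M ≠ 0 := by
      rw [hMdef, Finset.prod_ne_zero_iff]
      intro i _ h
      apply eval_neg_diffPoly_ne_zero hdis i
      exact eval_eq_zero_of_dvd_of_eval_eq_zero hdvd h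
    have hMle : (M.natAbs : ℝ) ≤ (N : ℝ) ^ ((6 * k * k : ℕ) : ℝ) := by
      rw [Real.rpow_natCast]
      have h1 : |M| ≤ (N : ℤ) ^ (6 * k * k) := by
        rw [hMdef, Finset.abs_prod, pow_mul]
        refine (Finset.prod_le_prod (fun i _ => abs_nonneg _) (fun i _ => ?_)).trans_eq
          (by rw [Finset.prod_const, Finset.card_univ, Fintype.card_fin])
        refine abs_eval_le_pow_of_dvd_diffPoly hk (by omega) (fun i => (hx0 i).2)
          (fun i => (hy0 i).2) hdis hdvd ?_
        rw [abs_neg, Nat.abs_cast]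
        exact_mod_cast (hy0 i).2
      rw [Nat.cast_natAbs]
      exact_mod_cast h1
    set V := (Finset.Icc 1 N).filter fun n : ℕ => f.eval (-(n : ℤ)) ∣ M
    have hV : (V.card : ℝ) ≤ 2 * k * Real.exp (A * g) := by
      have h1 := card_filter_eval_neg_dvd_le hf (Finset.Icc 1 N) hM
      have h2 := hdiv N hN' M.natAbs (Int.natAbs_ne_zero.2 hM) hMle
      calc (V.card : ℝ) ≤ 2 * f.natDegree * M.natAbs.divisors.card := by exact_mod_cast h1
        _ ≤ _ := by gcongr
    have hcard : (S.filter fun u => u.2 = u₀.2).card ≤ V.card ^ k := by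
      have : (Fintype.piFinset fun _ : Fin k => V).card = V.card ^ k := by
        simp [Fintype.card_piFinset]
      rw [← this]
      refine Finset.card_le_card_of_injOn Prod.fst ?_ ?_
      · intro u hu
        simp only [S, Finset.coe_filter, Finset.mem_filter, mem_disjointPairs,
          Set.mem_ofPred_eq] at hu
        obtain ⟨⟨⟨⟨hx, hy⟩, hd⟩, hdv⟩, hu2⟩ := hu
        rw [Finset.mem_coe, Fintype.mem_piFinset]
        intro i
        rw [Finset.mem_filter, Finset.mem_Icc]
        refine ⟨hx i, ?_⟩
        rw [hMdef, ← hu2, ← prod_eval_neg_eq_of_dvd_diffPoly (diffPoly_ne_zero hk hd) hdv]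
        exact Finset.dvd_prod_of_mem _ (Finset.mem_univ i)
      · intro u hu v hv huv
        simp only [Finset.coe_filter, Set.mem_ofPred_eq] at hu hv
        exact Prod.ext huv (hu.2.trans hv.2.symm)
    calc ((S.filter fun u => u.2 = u₀.2).card : ℝ) ≤ (V.card : ℝ) ^ k := by exact_mod_cast hcard
      _ ≤ (2 * k * Real.exp (A * g)) ^ k := by gcongr
      _ ≤ (Real.exp (2 * k * g) * Real.exp (A * g)) ^ k := by
        gcongr
        have h1 := Real.add_one_le_exp (2 * k * g)
        have h2 : (2 * k : ℝ) * 1 ≤ 2 * k * g := by gcongr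
        linarith
      _ = _ := by
        rw [← Real.exp_add, ← Real.exp_nat_mul]
        congr 1
        ring
  have hmaps : ∀ u ∈ S, u.2 ∈ box k N := by
    intro u hu
    simp only [S, Finset.mem_filter, mem_disjointPairs] at hu
    exact mem_box.2 hu.1.1.2
  rw [Finset.card_eq_sum_card_fiberwise hmaps]
  push_cast
  refine (Finset.sum_le_sum hfib).trans ?_
  rw [Finset.sum_const, card_box, nsmul_eq_mul]
  push_cast
  rfl

lemma exists_factor_of_resultant_eq_zero {P Q : ℤ[X]} (hP : P ≠ 0) (h : P.resultant Q = 0) :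
    ∃ f ∈ UniqueFactorizationMonoid.factors P, 0 < f.natDegree ∧ f ∣ Q := by
  have hinj : Function.Injective (Int.castRingHom ℚ) := (Int.castRingHom ℚ).injective_int
  have h1 : (P.map (Int.castRingHom ℚ)).resultant (Q.map (Int.castRingHom ℚ)) = 0 := by
    rw [natDegree_map_eq_of_injective hinj, natDegree_map_eq_of_injective hinj,
      resultant_map_map, h, map_zero]
  have hPQ : P.map (Int.castRingHom ℚ) ≠ 0 := by
    rwa [Ne, Polynomial.map_eq_zero_iff hinj]
  have h2 := (resultant_eq_zero_iff.1 h1).2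
  have h3 : ∃ z : ℚ[X], Irreducible z ∧ z ∣ P.map (Int.castRingHom ℚ) ∧
      z ∣ Q.map (Int.castRingHom ℚ) := by
    by_contra! hcon
    exact h2 (isCoprime_of_irreducible_dvd (fun h => hPQ h.1) fun z hz => hcon z hz)
  obtain ⟨z, hz, hzP, hzQ⟩ := h3
  have h4 : P.map (Int.castRingHom ℚ) ∣
      (UniqueFactorizationMonoid.factors P).prod.map (Int.castRingHom ℚ) :=
    Polynomial.map_dvd _ (UniqueFactorizationMonoid.factors_prod hP).symm.dvd
  rw [Polynomial.map_multiset_prod] at h4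
  obtain ⟨w, hw, hzw⟩ := hz.prime.exists_mem_multiset_dvd (hzP.trans h4)
  obtain ⟨f, hf, rfl⟩ := Multiset.mem_map.1 hw
  have hfirr := UniqueFactorizationMonoid.irreducible_of_factor f hf
  have hdeg : 0 < f.natDegree := by
    rw [Nat.pos_iff_ne_zero]
    intro h0
    have h5 : z.natDegree ≤ 0 := by
      refine (natDegree_le_of_dvd hzw ?_).trans ?_
      · rw [Ne, Polynomial.map_eq_zero_iff hinj]
        exact hfirr.ne_zero
      · rw [natDegree_map_eq_of_injective hinj, h0]
    exact hz.natDegree_pos.not_ge h5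
  have hprim : f.IsPrimitive := hfirr.isPrimitive hdeg.ne'
  refine ⟨f, hf, hdeg, ?_⟩
  have hfQ := (IsPrimitive.Int.irreducible_iff_irreducible_map_cast hprim).1 hfirr
  have hass : Associated z (f.map (Int.castRingHom ℚ)) := hz.associated_of_dvd hfQ hzw
  have h6 : f.map (Int.castRingHom ℚ) ∣ Q.map (Int.castRingHom ℚ) := hass.symm.dvd.trans hzQ
  exact (IsPrimitive.Int.dvd_iff_map_cast_dvd_map_cast _ _ hprim).2 h6

lemma card_factors_natDegree_pos_le {P : ℤ[X]} (hP : P ≠ 0) :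
    ((UniqueFactorizationMonoid.factors P).toFinset.filter fun f => 0 < f.natDegree).card ≤
      P.natDegree := by
  set F := UniqueFactorizationMonoid.factors P
  have h1 : P.natDegree = (F.map natDegree).sum := by
    rw [← natDegree_multiset_prod _ (fun h =>
      (UniqueFactorizationMonoid.irreducible_of_factor _ h).ne_zero rfl)]
    exact (natDegree_eq_of_degree_eq
      (degree_eq_degree_of_associated (UniqueFactorizationMonoid.factors_prod hP))).symm
  rw [h1, Finset.sum_multiset_map_count, Finset.card_eq_sum_ones]
  refine (Finset.sum_le_sum fun f hf => ?_).trans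
    (Finset.sum_le_sum_of_subset (Finset.filter_subset _ _))
  rw [Finset.mem_filter] at hf
  have : 1 ≤ F.count f := Multiset.one_le_count_iff_mem.2 (Multiset.mem_toFinset.1 hf.1)
  rw [smul_eq_mul]
  exact Nat.mul_pos this hf.2

lemma exists_card_resultant_eq_zero_le {k : ℕ} (hk : 1 ≤ k) : ∃ A : ℝ, 0 < A ∧ ∀ N : ℕ, 16 ≤ N →
    ∀ u ∈ disjointPairs k N,
      (((disjointPairs k N).filter fun v =>
        (diffPoly u.1 u.2).resultant (diffPoly v.1 v.2) = 0).card : ℝ) ≤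
        (N : ℝ) ^ k * Real.exp (A * (Real.log N / Real.log (Real.log N))) := by
  obtain ⟨A, hA, hdvd⟩ := exists_card_dvd_diffPoly_le hk
  refine ⟨k + A, by positivity, fun N hN u hu => ?_⟩
  have hN' : (16 : ℝ) ≤ N := by exact_mod_cast hN
  have hg : 1 ≤ Real.log N / Real.log (Real.log N) := one_le_log_div_log_log hN'
  have hP : diffPoly u.1 u.2 ≠ 0 := diffPoly_ne_zero hk (mem_disjointPairs.1 hu).2
  set F := (UniqueFactorizationMonoid.factors (diffPoly u.1 u.2)).toFinset.filter
    fun f => 0 < f.natDegree with hF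
  have hsub : ((disjointPairs k N).filter fun v =>
      (diffPoly u.1 u.2).resultant (diffPoly v.1 v.2) = 0) ⊆
      F.biUnion fun f => (disjointPairs k N).filter fun v => f ∣ diffPoly v.1 v.2 := by
    intro v hv
    rw [Finset.mem_filter] at hv
    obtain ⟨f, hf, hdeg, hfv⟩ := exists_factor_of_resultant_eq_zero hP hv.2
    rw [Finset.mem_biUnion]
    exact ⟨f, Finset.mem_filter.2 ⟨Multiset.mem_toFinset.2 hf, hdeg⟩,
      Finset.mem_filter.2 ⟨hv.1, hfv⟩⟩
  have h1 := (Finset.card_le_card hsub).trans Finset.card_biUnion_le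
  have hFk : F.card ≤ k := (card_factors_natDegree_pos_le hP).trans (natDegree_diffPoly_le _ _)
  calc _ ≤ ∑ f ∈ F, (((disjointPairs k N).filter fun v => f ∣ diffPoly v.1 v.2).card : ℝ) := by
        exact_mod_cast h1
    _ ≤ ∑ f ∈ F, (N : ℝ) ^ k * Real.exp (A * (Real.log N / Real.log (Real.log N))) :=
        Finset.sum_le_sum fun f hf => hdvd N hN f (Finset.mem_filter.1 hf).2
    _ = F.card * ((N : ℝ) ^ k * Real.exp (A * (Real.log N / Real.log (Real.log N)))) := by
        rw [Finset.sum_const, nsmul_eq_mul]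
    _ ≤ Real.exp (k * (Real.log N / Real.log (Real.log N))) *
          ((N : ℝ) ^ k * Real.exp (A * (Real.log N / Real.log (Real.log N)))) := by
        gcongr
        have h2 := Real.add_one_le_exp (k * (Real.log N / Real.log (Real.log N)))
        have h3 : (k : ℝ) * 1 ≤ k * (Real.log N / Real.log (Real.log N)) := by gcongr
        have h4 : (F.card : ℝ) ≤ k := by exact_mod_cast hFk
        linarith
    _ = _ := by
        rw [add_mul, Real.exp_add]
        ring
end

section
open scoped Classical

lemma natAbs_resultant_diffPoly_le {k N : ℕ} (hN : 2 ≤ N)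
    {u v : (Fin k → ℕ) × (Fin k → ℕ)} (hu : u ∈ disjointPairs k N) (hv : v ∈ disjointPairs k N) :
    ((diffPoly u.1 u.2).resultant (diffPoly v.1 v.2)).natAbs ≤ N ^ (8 * k ^ 2) := by
  rw [mem_disjointPairs] at hu hv
  have hPu := abs_coeff_diffPoly_le (fun i => (hu.1.1 i).2) (fun i => (hu.1.2 i).2)
  have hPv := abs_coeff_diffPoly_le (fun i => (hv.1.1 i).2) (fun i => (hv.1.2 i).2)
  set m := (diffPoly u.1 u.2).natDegree with hm
  set n := (diffPoly v.1 v.2).natDegree with hn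
  have hmn : m + n ≤ 2 * k := by
    have h1 : m ≤ k := natDegree_diffPoly_le u.1 u.2
    have h2 : n ≤ k := natDegree_diffPoly_le v.1 v.2
    omega
  have hent : ∀ i j, AbsoluteValue.abs
      ((diffPoly u.1 u.2).sylvester (diffPoly v.1 v.2) m n i j) ≤ ((N : ℤ) + 1) ^ k := by
    intro i j
    have hB : (0 : ℤ) ≤ ((N : ℤ) + 1) ^ k := by positivity
    rw [AbsoluteValue.abs_apply]
    induction j using Fin.addCases with
    | left j =>
      simp only [sylvester, Matrix.of_apply, Fin.addCases_left]
      split_ifs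
      · exact hPv _
      · simpa using hB
    | right j =>
      simp only [sylvester, Matrix.of_apply, Fin.addCases_right]
      split_ifs
      · exact hPu _
      · simpa using hB
  have h1 := Matrix.det_le hent
  rw [Fintype.card_fin, AbsoluteValue.abs_apply] at h1
  have h2 : ((m + n).factorial : ℤ) ≤ (N : ℤ) ^ (4 * k ^ 2) := by
    have e1 : (m + n).factorial ≤ (2 * k).factorial := Nat.factorial_le hmn
    have e2 := Nat.factorial_le_pow (2 * k)
    have e3 : (2 * k) ^ (2 * k) ≤ (2 ^ (2 * k)) ^ (2 * k) :=
      Nat.pow_le_pow_left Nat.lt_two_pow_self.le _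
    have e4 : (2 ^ (2 * k)) ^ (2 * k) = 2 ^ (4 * k ^ 2) := by
      rw [← pow_mul]; congr 1; ring
    have e5 := Nat.pow_le_pow_left hN (4 * k ^ 2)
    exact_mod_cast e1.trans (e2.trans (e3.trans (e4.le.trans e5)))
  have h3 : (((N : ℤ) + 1) ^ k) ^ (m + n) ≤ (N : ℤ) ^ (4 * k ^ 2) := by
    have hN' : (2 : ℤ) ≤ N := by exact_mod_cast hN
    have e1 : ((N : ℤ) + 1) ^ k ≤ ((N : ℤ) ^ 2) ^ k := by
      apply pow_le_pow_left₀ (by positivity)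
      nlinarith
    calc (((N : ℤ) + 1) ^ k) ^ (m + n) ≤ (((N : ℤ) ^ 2) ^ k) ^ (m + n) :=
          pow_le_pow_left₀ (by positivity) e1 _
      _ ≤ (((N : ℤ) ^ 2) ^ k) ^ (2 * k) := by
          apply pow_le_pow_right₀ _ hmn
          apply one_le_pow₀
          apply one_le_pow₀
          linarith
      _ = _ := by
          rw [← pow_mul, ← pow_mul]; congr 1; ring
  have h4 : |(diffPoly u.1 u.2).resultant (diffPoly v.1 v.2)| ≤ (N : ℤ) ^ (8 * k ^ 2) := by
    refine h1.trans ?_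
    rw [nsmul_eq_mul]
    calc _ ≤ (N : ℤ) ^ (4 * k ^ 2) * (N : ℤ) ^ (4 * k ^ 2) := by gcongr
      _ = _ := by rw [← pow_add]; congr 1; ring
  rw [Int.abs_eq_natAbs] at h4
  exact_mod_cast h4

lemma card_primeFactors_mul_log_two_le {n : ℕ} (hn : n ≠ 0) :
    (n.primeFactors.card : ℝ) * Real.log 2 ≤ Real.log n := by
  rw [← Real.log_pow]
  apply Real.log_le_log (by positivity)
  have h1 : 2 ^ n.primeFactors.card ≤ ∏ p ∈ n.primeFactors, p :=
    Finset.pow_card_le_prod _ _ _ fun p hp => (Nat.prime_of_mem_primeFactors hp).two_le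
  exact_mod_cast h1.trans (Nat.le_of_dvd (Nat.pos_of_ne_zero hn) (Nat.prod_primeFactors_dvd n))

/-- The solutions of `∏ (x i + s) = ∏ (y i + s)` in `ZMod p` with `x`, `y` in `{1, …, N} ^ k`
having no common entry. -/
noncomputable def disjointSolutions (p k N : ℕ) (s : ZMod p) :
    Finset ((Fin k → ℕ) × (Fin k → ℕ)) :=
  (disjointPairs k N).filter fun u =>
    ∏ i, ((u.1 i : ZMod p) + s) = ∏ i, ((u.2 i : ZMod p) + s)

lemma eval_map_diffPoly {p k : ℕ} (x y : Fin k → ℕ) (s : ZMod p) :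
    ((diffPoly x y).map (Int.castRingHom (ZMod p))).eval s =
      ∏ i, ((x i : ZMod p) + s) - ∏ i, ((y i : ZMod p) + s) := by
  rw [diffPoly, shiftPoly, shiftPoly, Polynomial.map_sub, Polynomial.map_prod,
    Polynomial.map_prod, eval_sub, eval_prod, eval_prod]
  congr 1 <;>
  · refine Finset.prod_congr rfl fun i _ => ?_
    rw [Polynomial.map_add, map_X, map_C, eval_add, eval_X, eval_C, add_comm, eq_intCast,
      Int.cast_natCast]

lemma mem_disjointSolutions {p k N : ℕ} {s : ZMod p} {u : (Fin k → ℕ) × (Fin k → ℕ)} :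
    u ∈ disjointSolutions p k N s ↔ u ∈ disjointPairs k N ∧
      ((diffPoly u.1 u.2).map (Int.castRingHom (ZMod p))).eval s = 0 := by
  rw [disjointSolutions, Finset.mem_filter, eval_map_diffPoly, sub_eq_zero]

lemma natCast_zmod_inj {p N a b : ℕ} (hN : N ≤ p) (ha : 1 ≤ a ∧ a ≤ N) (hb : 1 ≤ b ∧ b ≤ N)
    (h : (a : ZMod p) = b) : a = b := by
  rw [ZMod.natCast_eq_natCast_iff] at h
  have h' : a - 1 ≡ b - 1 [MOD p] := by
    apply Nat.ModEq.add_right_cancel' 1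
    rwa [Nat.sub_add_cancel ha.1, Nat.sub_add_cancel hb.1]
  have := h'.eq_of_lt_of_lt (by omega) (by omega)
  omega

lemma eval_map_diffPoly_ne_zero {p k N : ℕ} (hp : p.Prime) (hN : N ≤ p)
    {u : (Fin k → ℕ) × (Fin k → ℕ)} (hu : u ∈ disjointPairs k N) (i : Fin k) :
    ((diffPoly u.1 u.2).map (Int.castRingHom (ZMod p))).eval (-(u.2 i : ZMod p)) ≠ 0 := by
  have := Fact.mk hp
  rw [mem_disjointPairs] at hu
  rw [eval_map_diffPoly]
  have : ∏ j, ((u.2 j : ZMod p) + -(u.2 i : ZMod p)) = 0 :=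
    Finset.prod_eq_zero (Finset.mem_univ i) (add_neg_cancel _)
  rw [this, sub_zero, Finset.prod_ne_zero_iff]
  intro j _ h
  rw [← sub_eq_add_neg, sub_eq_zero] at h
  exact hu.2 j i (natCast_zmod_inj hN (hu.1.1 j) (hu.1.2 i) h)

lemma dvd_resultant_of_mem_disjointSolutions {p k N : ℕ} (hk : 1 ≤ k) (hp : p.Prime) (hN : N ≤ p)
    {s : ZMod p} {u v : (Fin k → ℕ) × (Fin k → ℕ)} (hu : u ∈ disjointSolutions p k N s)
    (hv : v ∈ disjointSolutions p k N s) :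
    (p : ℤ) ∣ (diffPoly u.1 u.2).resultant (diffPoly v.1 v.2) := by
  rw [mem_disjointSolutions] at hu hv
  have hdeg : (diffPoly u.1 u.2).natDegree ≠ 0 := by
    intro h
    have h1 := eval_map_diffPoly_ne_zero hp hN hu.1 ⟨0, hk⟩
    have h2 := hu.2
    rw [eq_C_of_natDegree_eq_zero h, map_C, eval_C] at h1 h2
    exact h1 h2
  obtain ⟨a, b, -, -, hab⟩ := exists_mul_add_mul_eq_C_resultant (diffPoly u.1 u.2)
    (diffPoly v.1 v.2) le_rfl le_rfl (Or.inl hdeg)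
  have h1 := congrArg (fun q => (q.map (Int.castRingHom (ZMod p))).eval s) hab
  simp only [Polynomial.map_add, Polynomial.map_mul, eval_add, eval_mul, hu.2, hv.2, zero_mul,
    add_zero, map_C, eval_C] at h1
  exact (ZMod.intCast_zmod_eq_zero_iff_dvd _ p).1 h1.symm

lemma card_shifts_le {p k N H : ℕ} (hk : 1 ≤ k) (hp : p.Prime) (hN : N ≤ p) (hH : H ≤ p)
    (s : ZMod p) {u : (Fin k → ℕ) × (Fin k → ℕ)} (hu : u ∈ disjointPairs k N) :
    ((Finset.range H).filter fun t : ℕ => u ∈ disjointSolutions p k N (s - t)).card ≤ k := by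
  have := Fact.mk hp
  set P := (diffPoly u.1 u.2).map (Int.castRingHom (ZMod p)) with hP
  have hP0 : P ≠ 0 := by
    intro h
    apply eval_map_diffPoly_ne_zero hp hN hu ⟨0, hk⟩
    rw [← hP, h, eval_zero]
  have h1 : ((Finset.range H).filter fun t : ℕ => u ∈ disjointSolutions p k N (s - t)).card ≤
      P.roots.toFinset.card := by
    refine Finset.card_le_card_of_injOn (fun t : ℕ => s - (t : ZMod p)) ?_ ?_
    · intro t ht
      have h2 := (mem_disjointSolutions.1 (Finset.mem_filter.1 ht).2).2
      rw [Finset.mem_coe, Multiset.mem_toFinset, mem_roots hP0]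
      exact h2
    · intro a ha b hb h
      have ha' := Finset.mem_range.1 (Finset.mem_filter.1 (Finset.mem_coe.1 ha)).1
      have hb' := Finset.mem_range.1 (Finset.mem_filter.1 (Finset.mem_coe.1 hb)).1
      have h2 : (a : ZMod p) = b := sub_right_injective h
      rw [ZMod.natCast_eq_natCast_iff] at h2
      exact h2.eq_of_lt_of_lt (by omega) (by omega)
  refine h1.trans ((Multiset.toFinset_card_le _).trans ((card_roots' _).trans ?_))
  exact natDegree_map_le.trans (natDegree_diffPoly_le _ _)

lemma card_disjointSolutions_le_shift {p k H t : ℕ} (ht : t ≤ H) (s : ZMod p) :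
    (disjointSolutions p k H s).card ≤ (disjointSolutions p k (2 * H) (s - t)).card := by
  refine Finset.card_le_card_of_injOn
    (fun u => (fun i => u.1 i + t, fun i => u.2 i + t)) ?_ ?_
  · intro u hu
    simp only [disjointSolutions, Finset.mem_coe, Finset.mem_filter, mem_disjointPairs] at hu ⊢
    obtain ⟨⟨⟨h1, h2⟩, h3⟩, h4⟩ := hu
    refine ⟨⟨⟨fun i => ?_, fun i => ?_⟩, fun i j h => h3 i j (by omega)⟩, ?_⟩
    · have := h1 i
      omega
    · have := h2 i
      omega
    · have e : ∀ a : ℕ, ((a + t : ℕ) : ZMod p) + (s - t) = a + s := by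
        intro a
        push_cast
        ring
      simpa only [e] using h4
  · intro u _ v _ h
    simp only [Prod.mk.injEq, funext_iff, Nat.add_right_cancel_iff] at h
    exact Prod.ext (funext h.1) (funext h.2)

/-- The pairs of elements of `disjointPairs k N` with nonzero resultant. -/
noncomputable def coprimePairs (k N : ℕ) :
    Finset (((Fin k → ℕ) × (Fin k → ℕ)) × ((Fin k → ℕ) × (Fin k → ℕ))) :=
  (disjointPairs k N ×ˢ disjointPairs k N).filter fun w =>
    (diffPoly w.1.1 w.1.2).resultant (diffPoly w.2.1 w.2.2) ≠ 0

lemma sq_card_le_card_coprimePairs {p k N : ℕ} {s : ZMod p} {B J : ℝ}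
    (hB : ∀ u ∈ disjointPairs k N, (((disjointPairs k N).filter fun v =>
        (diffPoly u.1 u.2).resultant (diffPoly v.1 v.2) = 0).card : ℝ) ≤ B)
    (hJ0 : 0 ≤ J) (hJ : J ≤ (disjointSolutions p k N s).card) (hJB : 2 * B ≤ J) :
    J ^ 2 / 2 ≤ ((coprimePairs k N).filter fun w =>
      w.1 ∈ disjointSolutions p k N s ∧ w.2 ∈ disjointSolutions p k N s).card := by
  set S := disjointSolutions p k N s with hS
  set R := fun u v : (Fin k → ℕ) × (Fin k → ℕ) => (diffPoly u.1 u.2).resultant (diffPoly v.1 v.2)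
  have hSD : S ⊆ disjointPairs k N := Finset.filter_subset _ _
  have h1 : ((coprimePairs k N).filter fun w => w.1 ∈ S ∧ w.2 ∈ S) =
      (S ×ˢ S).filter fun w => R w.1 w.2 ≠ 0 := by
    ext w
    simp only [coprimePairs, Finset.mem_filter, Finset.mem_product]
    constructor
    · rintro ⟨⟨-, h⟩, h'⟩
      exact ⟨h', h⟩
    · rintro ⟨h', h⟩
      exact ⟨⟨⟨hSD h'.1, hSD h'.2⟩, h⟩, h'⟩
  have h2 : (((S ×ˢ S).filter fun w => R w.1 w.2 = 0).card : ℝ) ≤ S.card * B := by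
    have e : ((S ×ˢ S).filter fun w => R w.1 w.2 = 0).card =
        ∑ u ∈ S, (S.filter fun v => R u v = 0).card := by
      simp only [Finset.card_filter, Finset.sum_product]
    rw [e]
    push_cast
    rw [← nsmul_eq_mul, ← Finset.sum_const]
    refine Finset.sum_le_sum fun u hu => le_trans ?_ (hB u (hSD hu))
    exact_mod_cast Finset.card_le_card (Finset.filter_subset_filter _ hSD)
  have h3 := Finset.card_filter_add_card_filter_not (s := S ×ˢ S) (fun w => R w.1 w.2 = 0)
  rw [Finset.card_product] at h3
  have h3' : (((S ×ˢ S).filter fun w => R w.1 w.2 = 0).card : ℝ) +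
      ((S ×ˢ S).filter fun w => R w.1 w.2 ≠ 0).card = S.card * S.card := by exact_mod_cast h3
  rw [h1]
  nlinarith

lemma sum_card_coprimePairs_le {k N H : ℕ} (hk : 1 ≤ k) (hN : 2 ≤ N) (hH : H ≤ N) (Q : Finset ℕ)
    (hQ : ∀ p ∈ Q, p.Prime ∧ N ≤ p) (s : ∀ p : ℕ, ZMod p) :
    ∑ p ∈ Q, ∑ t ∈ Finset.range H, (((coprimePairs k N).filter fun w =>
      w.1 ∈ disjointSolutions p k N (s p - t) ∧ w.2 ∈ disjointSolutions p k N (s p - t)).card : ℝ)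
      ≤ (N : ℝ) ^ (4 * k) * (16 * k ^ 3 * Real.log N) := by
  have hpair : ∀ w ∈ coprimePairs k N, ∑ p ∈ Q, (((Finset.range H).filter fun t : ℕ =>
      w.1 ∈ disjointSolutions p k N (s p - t) ∧
        w.2 ∈ disjointSolutions p k N (s p - t)).card : ℝ) ≤ 16 * k ^ 3 * Real.log N := by
    intro w hw
    simp only [coprimePairs, Finset.mem_filter, Finset.mem_product] at hw
    set R := (diffPoly w.1.1 w.1.2).resultant (diffPoly w.2.1 w.2.2)
    have hterm : ∀ p ∈ Q, (((Finset.range H).filter fun t : ℕ =>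
      w.1 ∈ disjointSolutions p k N (s p - t) ∧
        w.2 ∈ disjointSolutions p k N (s p - t)).card : ℝ) ≤
        if p ∈ R.natAbs.primeFactors then (k : ℝ) else 0 := by
      intro p hp
      obtain ⟨hpp, hpN⟩ := hQ p hp
      split_ifs with h
      · have h1 := card_shifts_le hk hpp hpN (hH.trans hpN) (s p) hw.1.1
        refine le_trans ?_ (Nat.cast_le.2 h1)
        rw [Nat.cast_le]
        refine Finset.card_le_card fun t ht => ?_
        rw [Finset.mem_filter] at ht ⊢
        exact ⟨ht.1, ht.2.1⟩
      · rw [Finset.card_eq_zero.2, Nat.cast_zero]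
        rw [Finset.filter_eq_empty_iff]
        rintro t - ⟨h1, h2⟩
        apply h
        rw [Nat.mem_primeFactors]
        refine ⟨hpp, ?_, Int.natAbs_ne_zero.2 hw.2⟩
        exact Int.natCast_dvd.1 (dvd_resultant_of_mem_disjointSolutions hk hpp hpN h1 h2)
    refine (Finset.sum_le_sum hterm).trans ?_
    rw [← Finset.sum_filter, Finset.sum_const, nsmul_eq_mul]
    have h1 : ((Q.filter fun p => p ∈ R.natAbs.primeFactors).card : ℝ) ≤
        R.natAbs.primeFactors.card := by
      exact_mod_cast Finset.card_le_card fun p hp => (Finset.mem_filter.1 hp).2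
    have h2 := card_primeFactors_mul_log_two_le (Int.natAbs_ne_zero.2 hw.2)
    have h3 : Real.log R.natAbs ≤ (8 * k ^ 2 : ℕ) * Real.log N := by
      rw [← Real.log_pow]
      apply Real.log_le_log
      · exact_mod_cast Int.natAbs_pos.2 hw.2
      · exact_mod_cast natAbs_resultant_diffPoly_le hN hw.1.1 hw.1.2
    have h4 : (1 : ℝ) / 2 ≤ Real.log 2 := by
      have := Real.log_two_gt_d9
      linarith
    have h5 : (R.natAbs.primeFactors.card : ℝ) ≤ 16 * k ^ 2 * Real.log N := by
      push_cast at h3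
      have : (R.natAbs.primeFactors.card : ℝ) * (1 / 2) ≤
        R.natAbs.primeFactors.card * Real.log 2 := by gcongr
      linarith
    calc _ ≤ (16 * k ^ 2 * Real.log N) * k := by gcongr; exact h1.trans h5
      _ = _ := by ring
  have hcomm : ∑ p ∈ Q, ∑ t ∈ Finset.range H, (((coprimePairs k N).filter fun w =>
      w.1 ∈ disjointSolutions p k N (s p - t) ∧ w.2 ∈ disjointSolutions p k N (s p - t)).card : ℝ)
      = ∑ w ∈ coprimePairs k N, ∑ p ∈ Q, (((Finset.range H).filter fun t : ℕ =>
      w.1 ∈ disjointSolutions p k N (s p - t) ∧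
        w.2 ∈ disjointSolutions p k N (s p - t)).card : ℝ) := by
    rw [Finset.sum_comm (s := coprimePairs k N)]
    refine Finset.sum_congr rfl fun p _ => ?_
    simp only [Finset.card_filter, Nat.cast_sum]
    rw [Finset.sum_comm]
  rw [hcomm]
  refine (Finset.sum_le_sum hpair).trans ?_
  rw [Finset.sum_const, nsmul_eq_mul]
  have hcard : (coprimePairs k N).card ≤ N ^ (4 * k) := by
    have h1 : (disjointPairs k N).card ≤ N ^ k * N ^ k := by
      refine (Finset.card_filter_le _ _).trans ?_
      rw [Finset.card_product, card_box]
    refine (Finset.card_filter_le _ _).trans ?_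
    rw [Finset.card_product]
    calc _ ≤ (N ^ k * N ^ k) * (N ^ k * N ^ k) := Nat.mul_le_mul h1 h1
      _ = _ := by ring
  have hlog : 0 ≤ Real.log N := Real.log_natCast_nonneg N
  have hcard' : ((coprimePairs k N).card : ℝ) ≤ (N : ℝ) ^ (4 * k) := by exact_mod_cast hcard
  gcongr

lemma log_div_log_log_two_mul_le {H : ℝ} (hH : 16 ≤ H) :
    Real.log (2 * H) / Real.log (Real.log (2 * H)) ≤
      2 * (Real.log H / Real.log (Real.log H)) := by
  have hL1 : 1 < Real.log H := by
    rw [Real.lt_log_iff_exp_lt (by linarith)]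
    have := Real.exp_one_lt_d9
    linarith
  have h1 : Real.log (2 * H) ≤ 2 * Real.log H := by
    rw [Real.log_mul (by norm_num) (by linarith)]
    have : Real.log 2 ≤ Real.log H := Real.log_le_log (by norm_num) (by linarith)
    linarith
  have h2 : Real.log H ≤ Real.log (2 * H) := Real.log_le_log (by linarith) (by linarith)
  rw [← mul_div_assoc]
  have := Real.log_pos hL1
  have := Real.log_le_log (by linarith) h2
  gcongr

lemma exists_card_primes_le {k : ℕ} (hk : 1 ≤ k) : ∃ A : ℝ, 0 < A ∧ ∀ H : ℕ, 16 ≤ H →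
    ∀ Q : Finset ℕ, (∀ p ∈ Q, p.Prime ∧ 2 * H ≤ p) → ∀ Z : ℝ, 0 ≤ Z →
      (∀ p ∈ Q, ∃ s : ZMod p, (H : ℝ) ^ k * Real.exp (A * (Real.log H / Real.log (Real.log H))) ≤
        (disjointSolutions p k H s).card ∧ Z ≤ (disjointSolutions p k H s).card) →
      Q.card * Z ^ 2 * H ≤ A * (H : ℝ) ^ (4 * k) * Real.log H := by
  obtain ⟨A, hA, hres⟩ := exists_card_resultant_eq_zero_le hk
  refine ⟨2 * A + k + 1 + 64 * k ^ 3 * 2 ^ (4 * k), by positivity, fun H hH Q hQ Z hZ hs => ?_⟩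
  have hH' : (16 : ℝ) ≤ H := by exact_mod_cast hH
  set g := Real.log H / Real.log (Real.log H)
  have hg : 1 ≤ g := one_le_log_div_log_log hH'
  have hlogH : 0 ≤ Real.log H := Real.log_natCast_nonneg H
  set B : ℝ := ((2 * H : ℕ) : ℝ) ^ k *
    Real.exp (A * (Real.log (2 * H : ℕ) / Real.log (Real.log (2 * H : ℕ)))) with hB
  have hBJ : 2 * B ≤ (H : ℝ) ^ k * Real.exp ((2 * A + k + 1 + 64 * k ^ 3 * 2 ^ (4 * k)) * g) := by
    have h1 := log_div_log_log_two_mul_le hH'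
    have h2 : (2 : ℝ) * 2 ^ k ≤ Real.exp ((k + 1) * g) := by
      have e1 : (2 : ℝ) ≤ Real.exp 1 := by
        have := Real.add_one_le_exp (1 : ℝ)
        linarith
      calc (2 : ℝ) * 2 ^ k = 2 ^ (k + 1) := by ring
        _ ≤ Real.exp 1 ^ (k + 1) := by gcongr
        _ = Real.exp ((k + 1) * 1) := by rw [← Real.exp_nat_mul]; push_cast; rfl
        _ ≤ _ := by gcongr
    rw [hB]
    push_cast
    calc _ = (H : ℝ) ^ k * ((2 * 2 ^ k) *
          Real.exp (A * (Real.log (2 * H) / Real.log (Real.log (2 * H))))) := by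
          rw [mul_pow]; ring
      _ ≤ (H : ℝ) ^ k * (Real.exp ((k + 1) * g) * Real.exp (A * (2 * g))) := by gcongr
      _ ≤ _ := by
          rw [← Real.exp_add]
          gcongr
          have : 0 ≤ (64 * k ^ 3 * 2 ^ (4 * k) : ℝ) * g := by positivity
          linarith
  have hs' : ∀ p : ℕ, ∃ s : ZMod p, p ∈ Q → (H : ℝ) ^ k *
      Real.exp ((2 * A + k + 1 + 64 * k ^ 3 * 2 ^ (4 * k)) * g) ≤
        (disjointSolutions p k H s).card ∧ Z ≤ (disjointSolutions p k H s).card := by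
    intro p
    by_cases hp : p ∈ Q
    · obtain ⟨s, h⟩ := hs p hp
      exact ⟨s, fun _ => h⟩
    · exact ⟨0, fun h => absurd h hp⟩
  choose s hs using hs'
  have hup := sum_card_coprimePairs_le hk (N := 2 * H) (H := H) (by omega) (by omega) Q hQ s
  have hlow : ∑ p ∈ Q, ∑ t ∈ Finset.range H, Z ^ 2 / 2 ≤
      ∑ p ∈ Q, ∑ t ∈ Finset.range H, (((coprimePairs k (2 * H)).filter fun w =>
      w.1 ∈ disjointSolutions p k (2 * H) (s p - t) ∧
        w.2 ∈ disjointSolutions p k (2 * H) (s p - t)).card : ℝ) := by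
    refine Finset.sum_le_sum fun p hp => Finset.sum_le_sum fun t ht => ?_
    have h1 := card_disjointSolutions_le_shift (k := k) (Finset.mem_range.1 ht).le (s p)
    have h2 := hs p hp
    have h3 := sq_card_le_card_coprimePairs (p := p) (s := s p - t)
      (hres (2 * H) (by omega)) (Nat.cast_nonneg (disjointSolutions p k H (s p)).card)
      (Nat.cast_le.2 h1) (hBJ.trans h2.1)
    refine le_trans ?_ h3
    have := h2.2
    gcongr
  have h := hlow.trans hup
  rw [Finset.sum_const, Finset.sum_const, Finset.card_range, nsmul_eq_mul, nsmul_eq_mul] at h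
  push_cast at h
  have hlog : Real.log (2 * H) ≤ 2 * Real.log H := by
    rw [Real.log_mul (by norm_num) (by linarith)]
    have : Real.log 2 ≤ Real.log H := Real.log_le_log (by norm_num) (by linarith)
    linarith
  calc (Q.card : ℝ) * Z ^ 2 * H = 2 * (Q.card * (H * (Z ^ 2 / 2))) := by ring
    _ ≤ 2 * ((2 * H) ^ (4 * k) * (16 * k ^ 3 * Real.log (2 * H))) := by gcongr
    _ ≤ 2 * ((2 * H) ^ (4 * k) * (16 * k ^ 3 * (2 * Real.log H))) := by gcongr
    _ = (64 * k ^ 3 * 2 ^ (4 * k)) * H ^ (4 * k) * Real.log H := by rw [mul_pow]; ring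
    _ ≤ _ := by
      gcongr
      have : (0 : ℝ) ≤ k := by positivity
      linarith
end

end

section
open scoped Classical

/-- The tuples `x` in `{1, …, N} ^ k` with all `x i + s` nonzero in `ZMod p`. -/
noncomputable def unitBox (p k N : ℕ) (s : ZMod p) : Finset (Fin k → ℕ) :=
  (box k N).filter fun x => ∀ i, (x i : ZMod p) + s ≠ 0

lemma mem_unitBox {p k N : ℕ} {s : ZMod p} {x : Fin k → ℕ} : x ∈ unitBox p k N s ↔
    (∀ i, 1 ≤ x i ∧ x i ≤ N) ∧ ∀ i, (x i : ZMod p) + s ≠ 0 := by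
  rw [unitBox, Finset.mem_filter, mem_box]

/-- The solutions of `∏ (x i + s) = ∏ (y i + s) ≠ 0` in `ZMod p` with `x`, `y` in
`{1, …, N} ^ k`. -/
noncomputable def unitSolutions (p k N : ℕ) (s : ZMod p) :
    Finset ((Fin k → ℕ) × (Fin k → ℕ)) :=
  (unitBox p k N s ×ˢ unitBox p k N s).filter fun u =>
    ∏ i, ((u.1 i : ZMod p) + s) = ∏ i, ((u.2 i : ZMod p) + s)

lemma card_unitSolutions_succ_le {p k N : ℕ} (hp : p.Prime) (s : ZMod p) :
    (unitSolutions p (k + 1) N s).card ≤ (disjointSolutions p (k + 1) N s).card +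
      (k + 1) ^ 2 * (N * (unitSolutions p k N s).card) := by
  have := Fact.mk hp
  set T : Fin (k + 1) × Fin (k + 1) → Finset ((Fin (k + 1) → ℕ) × (Fin (k + 1) → ℕ)) := fun a =>
    (unitSolutions p (k + 1) N s).filter fun u => u.1 a.1 = u.2 a.2 with hT
  have h1 : unitSolutions p (k + 1) N s ⊆
      disjointSolutions p (k + 1) N s ∪ Finset.univ.biUnion T := by
    intro u hu
    rw [Finset.mem_union]
    by_cases h : ∀ i j, u.1 i ≠ u.2 j
    · left
      simp only [unitSolutions, Finset.mem_filter, Finset.mem_product, mem_unitBox] at hu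
      rw [disjointSolutions, Finset.mem_filter, mem_disjointPairs]
      exact ⟨⟨⟨hu.1.1.1, hu.1.2.1⟩, h⟩, hu.2⟩
    · right
      push Not at h
      obtain ⟨i, j, h⟩ := h
      exact Finset.mem_biUnion.2 ⟨(i, j), Finset.mem_univ _, Finset.mem_filter.2 ⟨hu, h⟩⟩
  have h2 : ∀ a, (T a).card ≤ N * (unitSolutions p k N s).card := by
    rintro ⟨i, j⟩
    have e : N * (unitSolutions p k N s).card =
        (Finset.Icc 1 N ×ˢ unitSolutions p k N s).card := by
      rw [Finset.card_product, Nat.card_Icc, Nat.add_sub_cancel]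
    rw [e]
    refine Finset.card_le_card_of_injOn
      (fun u => (u.1 i, (i.removeNth u.1, j.removeNth u.2))) ?_ ?_
    · intro u hu
      simp only [hT, unitSolutions, Finset.mem_coe, Finset.mem_filter, Finset.mem_product,
        mem_unitBox, Finset.mem_Icc] at hu ⊢
      obtain ⟨⟨⟨⟨h1, h2⟩, h3, h4⟩, h5⟩, h6⟩ := hu
      refine ⟨h1 i, ⟨⟨fun l => h1 _, fun l => h2 _⟩, fun l => h3 _, fun l => h4 _⟩, ?_⟩
      rw [Fin.prod_univ_succAbove _ i, Fin.prod_univ_succAbove _ j, h6] at h5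
      exact mul_left_cancel₀ (h4 j) h5
    · intro u hu v hv h
      simp only [Prod.mk.injEq] at h
      have hu' := (Finset.mem_filter.1 (Finset.mem_coe.1 hu)).2
      have hv' := (Finset.mem_filter.1 (Finset.mem_coe.1 hv)).2
      dsimp only at hu' hv'
      refine Prod.ext ?_ ?_
      · rw [← Fin.insertNth_self_removeNth i u.1, ← Fin.insertNth_self_removeNth i v.1,
          h.1, h.2.1]
      · rw [← Fin.insertNth_self_removeNth j u.2, ← Fin.insertNth_self_removeNth j v.2,
          h.2.2, ← hu', ← hv', h.1]
  refine (Finset.card_le_card h1).trans ((Finset.card_union_le _ _).trans ?_)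
  refine Nat.add_le_add_left (Finset.card_biUnion_le.trans ?_) _
  refine (Finset.sum_le_sum fun a _ => h2 a).trans ?_
  rw [Finset.sum_const, Finset.card_univ, Fintype.card_prod, Fintype.card_fin, smul_eq_mul, sq]

lemma exists_card_unitSolutions_le (k : ℕ) : ∃ K : ℝ, 1 ≤ K ∧ ∀ p N : ℕ, p.Prime → 1 ≤ N →
    ∀ (s : ZMod p) (D r : ℝ), 1 ≤ D → 0 < r →
      (∀ j, 1 ≤ j → j ≤ k → ((disjointSolutions p j N s).card : ℝ) ≤
        D * ((N : ℝ) ^ j + (N : ℝ) ^ (2 * j) / r)) →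
      ((unitSolutions p k N s).card : ℝ) ≤
        K * D * ((N : ℝ) ^ k + (N : ℝ) ^ (2 * k) / r) := by
  induction k with
  | zero =>
    refine ⟨1, le_rfl, fun p N _ _ s D r hD hr _ => ?_⟩
    have h1 : ((unitSolutions p 0 N s).card : ℝ) ≤ 1 := by
      exact_mod_cast Finset.card_le_one_of_subsingleton _
    refine h1.trans ?_
    simp only [mul_zero, pow_zero, one_mul]
    have : 0 ≤ 1 / r := by positivity
    nlinarith
  | succ k ih =>
    obtain ⟨K, hK, ih⟩ := ih
    refine ⟨1 + (k + 1) ^ 2 * K, ?_, fun p N hp hN s D r hD hr h => ?_⟩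
    · have : 0 ≤ ((k : ℝ) + 1) ^ 2 * K := by positivity
      linarith
    have h1 := ih p N hp hN s D r hD hr fun j h1 h2 => h j h1 (h2.trans (Nat.le_succ k))
    have h2 := h (k + 1) (by omega) le_rfl
    have h3 : ((unitSolutions p (k + 1) N s).card : ℝ) ≤
        (disjointSolutions p (k + 1) N s).card +
          ((k : ℝ) + 1) ^ 2 * (N * (unitSolutions p k N s).card) := by
      exact_mod_cast card_unitSolutions_succ_le hp s
    have hN' : (1 : ℝ) ≤ N := by exact_mod_cast hN
    have h4 : (N : ℝ) * ((N : ℝ) ^ k + (N : ℝ) ^ (2 * k) / r) ≤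
        (N : ℝ) ^ (k + 1) + (N : ℝ) ^ (2 * (k + 1)) / r := by
      have e : (N : ℝ) * ((N : ℝ) ^ k + (N : ℝ) ^ (2 * k) / r) =
        (N : ℝ) ^ (k + 1) + (N : ℝ) ^ (2 * k + 1) / r := by ring
      rw [e]
      have : (N : ℝ) ^ (2 * k + 1) ≤ (N : ℝ) ^ (2 * (k + 1)) :=
        pow_le_pow_right₀ hN' (by omega)
      gcongr
    calc _ ≤ D * ((N : ℝ) ^ (k + 1) + (N : ℝ) ^ (2 * (k + 1)) / r) +
          ((k : ℝ) + 1) ^ 2 * (N * (K * D * ((N : ℝ) ^ k + (N : ℝ) ^ (2 * k) / r))) := by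
          refine h3.trans ?_
          gcongr
      _ = D * ((N : ℝ) ^ (k + 1) + (N : ℝ) ^ (2 * (k + 1)) / r) +
          ((k : ℝ) + 1) ^ 2 * K * D * (N * ((N : ℝ) ^ k + (N : ℝ) ^ (2 * k) / r)) := by ring
      _ ≤ D * ((N : ℝ) ^ (k + 1) + (N : ℝ) ^ (2 * (k + 1)) / r) +
          ((k : ℝ) + 1) ^ 2 * K * D *
            ((N : ℝ) ^ (k + 1) + (N : ℝ) ^ (2 * (k + 1)) / r) := by gcongr
      _ = _ := by ring

lemma sq_card_unitBox_le (p k N : ℕ) (s : ZMod p) :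
    (unitBox p k N s).card ^ 2 ≤
      ((box k N).image fun x => ∏ i, ((x i : ZMod p) + s)).card *
        (unitSolutions p k N s).card := by
  set f : (Fin k → ℕ) → ZMod p := fun x => ∏ i, ((x i : ZMod p) + s) with hf
  set G := unitBox p k N s
  set F : ZMod p → ℕ := fun z => (G.filter fun x => f x = z).card
  have h1 : G.card = ∑ z ∈ G.image f, F z := Finset.card_eq_sum_card_image f G
  have h2 : (unitSolutions p k N s).card = ∑ z ∈ G.image f, F z ^ 2 := by
    rw [Finset.card_eq_sum_card_fiberwise (f := fun u => f u.1) (t := G.image f)]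
    · refine Finset.sum_congr rfl fun z _ => ?_
      rw [sq, ← Finset.card_product]
      congr 1
      ext u
      simp only [unitSolutions, Finset.mem_filter, Finset.mem_product]
      constructor
      · rintro ⟨⟨⟨h1, h2⟩, h3⟩, h4⟩
        exact ⟨⟨h1, h4⟩, h2, h3.symm.trans h4⟩
      · rintro ⟨⟨h1, h4⟩, h2, h3⟩
        exact ⟨⟨⟨h1, h2⟩, h4.trans h3.symm⟩, h4⟩
    · intro u hu
      simp only [unitSolutions, Finset.mem_coe, Finset.mem_filter, Finset.mem_product] at hu
      exact Finset.mem_coe.2 (Finset.mem_image_of_mem f hu.1.1)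
  rw [h1, h2]
  refine sq_sum_le_card_mul_sum_sq.trans (Nat.mul_le_mul_right _ ?_)
  exact Finset.card_le_card (Finset.image_subset_image (Finset.filter_subset _ _))

lemma pow_le_card_unitBox {p N : ℕ} (k : ℕ) (hN : N ≤ p) (s : ZMod p) :
    (N - 1) ^ k ≤ (unitBox p k N s).card := by
  have h1 : unitBox p k N s =
      Fintype.piFinset fun _ => (Finset.Icc 1 N).filter fun a : ℕ => (a : ZMod p) + s ≠ 0 := by
    ext x
    simp only [mem_unitBox, Fintype.mem_piFinset, Finset.mem_filter, Finset.mem_Icc, forall_and]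
  rw [h1, Fintype.card_piFinset, Finset.prod_const, Finset.card_univ, Fintype.card_fin]
  apply Nat.pow_le_pow_left
  have h2 := Finset.card_filter_add_card_filter_not (s := Finset.Icc 1 N)
    (fun a : ℕ => (a : ZMod p) + s = 0)
  rw [Nat.card_Icc, Nat.add_sub_cancel] at h2
  have h3 : ((Finset.Icc 1 N).filter fun a : ℕ => (a : ZMod p) + s = 0).card ≤ 1 := by
    rw [Finset.card_le_one]
    intro a ha b hb
    rw [Finset.mem_filter, Finset.mem_Icc] at ha hb
    exact natCast_zmod_inj hN ha.1 hb.1 (add_right_cancel (ha.2.trans hb.2.symm))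
  simp only [ne_eq] at h2 h3 ⊢
  omega

lemma exists_le_card_image_box (k : ℕ) : ∃ c : ℝ, 0 < c ∧ ∀ p N : ℕ, p.Prime → 2 ≤ N → N ≤ p →
    ∀ (s : ZMod p) (D r : ℝ), 1 ≤ D → 0 < r →
      (∀ j, 1 ≤ j → j ≤ k → ((disjointSolutions p j N s).card : ℝ) ≤
        D * ((N : ℝ) ^ j + (N : ℝ) ^ (2 * j) / r)) →
      c * min ((N : ℝ) ^ k) r ≤
        D * ((box k N).image fun x => ∏ i, ((x i : ZMod p) + s)).card := by
  obtain ⟨K, hK, h⟩ := exists_card_unitSolutions_le k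
  refine ⟨1 / (2 * K * 4 ^ k), by positivity, fun p N hp hN hNp s D r hD hr hj => ?_⟩
  have hJ := h p N hp (by omega) s D r hD hr hj
  set S := (box k N).image fun x => ∏ i, ((x i : ZMod p) + s)
  have hCS : ((unitBox p k N s).card : ℝ) ^ 2 ≤ S.card * (unitSolutions p k N s).card := by
    exact_mod_cast sq_card_unitBox_le p k N s
  have hN0 : (0 : ℝ) < N := by
    have : 0 < N := by omega
    exact_mod_cast this
  have hG : ((N : ℝ) / 2) ^ k ≤ (unitBox p k N s).card := by
    have h1 : ((N - 1 : ℕ) : ℝ) ^ k ≤ (unitBox p k N s).card := by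
      exact_mod_cast pow_le_card_unitBox k hNp s
    refine le_trans ?_ h1
    have h2 : (N : ℝ) ≤ 2 * (N - 1 : ℕ) := by
      have : N ≤ 2 * (N - 1) := by omega
      exact_mod_cast this
    gcongr
    linarith
  have hmin : min ((N : ℝ) ^ k) r * ((N : ℝ) ^ k + (N : ℝ) ^ (2 * k) / r) ≤
      2 * (N : ℝ) ^ (2 * k) := by
    have h1 : min ((N : ℝ) ^ k) r * (N : ℝ) ^ k ≤ (N : ℝ) ^ (2 * k) := by
      rw [two_mul, pow_add]
      gcongr
      exact min_le_left _ _
    have h2 : min ((N : ℝ) ^ k) r * ((N : ℝ) ^ (2 * k) / r) ≤ (N : ℝ) ^ (2 * k) := by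
      calc _ ≤ r * ((N : ℝ) ^ (2 * k) / r) := by
            gcongr
            exact min_le_right _ _
        _ = _ := by field_simp
    linarith
  have hM : 0 < (N : ℝ) ^ (2 * k) := by positivity
  have hsq : (N : ℝ) ^ (2 * k) / 4 ^ k ≤
      S.card * (K * D * ((N : ℝ) ^ k + (N : ℝ) ^ (2 * k) / r)) := by
    calc (N : ℝ) ^ (2 * k) / 4 ^ k = (((N : ℝ) / 2) ^ k) ^ 2 := by
          rw [← pow_mul, div_pow, mul_comm k 2, pow_mul 2 2 k]
          norm_num
      _ ≤ ((unitBox p k N s).card : ℝ) ^ 2 := by gcongr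
      _ ≤ _ := hCS.trans (by gcongr)
  have hm0 : 0 < min ((N : ℝ) ^ k) r := by positivity
  have h5 : (N : ℝ) ^ (2 * k) / 4 ^ k * min ((N : ℝ) ^ k) r ≤
      S.card * (K * D) * (2 * (N : ℝ) ^ (2 * k)) := by
    calc _ ≤ S.card * (K * D * ((N : ℝ) ^ k + (N : ℝ) ^ (2 * k) / r)) *
          min ((N : ℝ) ^ k) r := by gcongr
      _ = S.card * (K * D) *
          (min ((N : ℝ) ^ k) r * ((N : ℝ) ^ k + (N : ℝ) ^ (2 * k) / r)) := by ring
      _ ≤ _ := by gcongr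
  have hK0 : 0 < K := by linarith
  rw [one_div, inv_mul_le_iff₀ (by positivity)]
  refine le_of_mul_le_mul_left ?_ hM
  rw [div_mul_eq_mul_div, div_le_iff₀ (by positivity)] at h5
  linarith
end

section
open Filter

lemma eventually_mul_pow_le_exp_div_log (B : ℝ) (n : ℕ) {c : ℝ} (hc : 0 < c) :
    ∀ᶠ L : ℝ in atTop, B * L ^ n ≤ Real.exp (c * (L / Real.log L)) := by
  have h1 : Tendsto (fun L : ℝ => L / Real.log L ^ 2) atTop atTop := by
    have h := (Real.isLittleO_pow_log_id_atTop (n := 2)).tendsto_div_nhds_zero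
    have h' : Tendsto (fun L : ℝ => Real.log L ^ 2 / L) atTop (nhdsWithin 0 (Set.Ioi 0)) := by
      refine tendsto_nhdsWithin_iff.2 ⟨h, ?_⟩
      filter_upwards [eventually_gt_atTop 1] with L hL
      have := Real.log_pos hL
      exact Set.mem_Ioi.2 (by positivity)
    refine h'.inv_tendsto_nhdsGT_zero.congr fun L => ?_
    rw [Pi.inv_apply, inv_div]
  filter_upwards [h1.eventually_ge_atTop ((n + |B|) / c), eventually_gt_atTop (Real.exp 1)]
    with L h hL
  have hL0 : 0 < L := (Real.exp_pos 1).trans hL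
  have hlog : 1 < Real.log L := (Real.lt_log_iff_exp_lt hL0).2 hL
  have h2 : |B| + n * Real.log L ≤ c * (L / Real.log L) := by
    rw [div_le_iff₀ hc] at h
    calc |B| + n * Real.log L ≤ (n + |B|) * Real.log L := by
          nlinarith [abs_nonneg B]
      _ ≤ L / Real.log L ^ 2 * c * Real.log L := by gcongr
      _ = _ := by field_simp
  refine le_trans ?_ (Real.exp_le_exp.2 h2)
  rw [Real.exp_add, Real.exp_nat_mul, Real.exp_log hL0]
  gcongr
  have := Real.add_one_le_exp |B|
  have := le_abs_self B
  linarith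

lemma eventually_mul_pow_le_exp_half (B : ℝ) (n : ℕ) :
    ∀ᶠ L : ℝ in atTop, B * L ^ n ≤ Real.exp (L / 2) := by
  filter_upwards [eventually_mul_pow_le_exp_div_log B n one_half_pos,
    eventually_gt_atTop (Real.exp 1)] with L h hL
  have hL0 : 0 < L := (Real.exp_pos 1).trans hL
  have hlog : 1 < Real.log L := (Real.lt_log_iff_exp_lt hL0).2 hL
  refine h.trans (Real.exp_le_exp.2 ?_)
  have := div_le_self hL0.le hlog.le
  linarith

lemma exists_card_exceptional_le (ν : ℕ) : ∃ A : ℝ, 0 < A ∧ ∀ k, 1 ≤ k → k ≤ ν →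
    ∀ H : ℕ, 16 ≤ H → ∀ T : ℝ, 0 < T → ∀ Q : Finset ℕ, (∀ p ∈ Q, p.Prime ∧ 2 * H ≤ p) →
      (∀ p ∈ Q, ∃ s : ZMod p, Real.exp (A * (Real.log H / Real.log (Real.log H))) *
        ((H : ℝ) ^ k + (H : ℝ) ^ (2 * k) / √(H * T)) ≤ (disjointSolutions p k H s).card) →
      Q.card ≤ A * (H : ℝ) ^ (2 * ν) * Real.log H ∧
        Q.card * Real.exp (2 * A * (Real.log H / Real.log (Real.log H))) ≤
          A * T * Real.log H := by
  have hex : ∀ k : ℕ, ∃ A : ℝ, 0 < A ∧ (1 ≤ k → ∀ H : ℕ, 16 ≤ H →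
    ∀ Q : Finset ℕ, (∀ p ∈ Q, p.Prime ∧ 2 * H ≤ p) → ∀ Z : ℝ, 0 ≤ Z →
      (∀ p ∈ Q, ∃ s : ZMod p, (H : ℝ) ^ k * Real.exp (A * (Real.log H / Real.log (Real.log H))) ≤
        (disjointSolutions p k H s).card ∧ Z ≤ (disjointSolutions p k H s).card) →
      Q.card * Z ^ 2 * H ≤ A * (H : ℝ) ^ (4 * k) * Real.log H) := by
    intro k
    by_cases hk : 1 ≤ k
    · obtain ⟨A, hA, h⟩ := exists_card_primes_le hk
      exact ⟨A, hA, fun _ => h⟩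
    · exact ⟨1, one_pos, fun h => absurd h hk⟩
  choose A hA hmain using hex
  refine ⟨∑ k ∈ Finset.range (ν + 1), A k, Finset.sum_pos (fun k _ => hA k) (by simp),
    fun k hk hkν H hH T hT Q hQ hs => ?_⟩
  have hAk : A k ≤ ∑ k ∈ Finset.range (ν + 1), A k :=
    Finset.single_le_sum (fun k _ => (hA k).le) (Finset.mem_range.2 (by omega))
  set A' := ∑ k ∈ Finset.range (ν + 1), A k
  have hA' : 0 < A' := (hA k).trans_le hAk
  have hH' : (16 : ℝ) ≤ H := by exact_mod_cast hH
  have hH0 : (0 : ℝ) < H := by linarith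
  have hH1 : (1 : ℝ) ≤ H := by linarith
  have hg := one_le_log_div_log_log hH'
  set g := Real.log H / Real.log (Real.log H)
  have hlogH : 0 ≤ Real.log H := Real.log_natCast_nonneg H
  set r := √(H * T) with hr
  have hr0 : 0 < r := by positivity
  have hr2 : r ^ 2 = H * T := Real.sq_sqrt (by positivity)
  set Z := Real.exp (A' * g) * ((H : ℝ) ^ k + (H : ℝ) ^ (2 * k) / r) with hZ
  have h := hmain k hk H hH Q hQ Z (by positivity) fun p hp => by
    obtain ⟨s, h⟩ := hs p hp
    refine ⟨s, le_trans ?_ h, h⟩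
    rw [hZ, mul_comm]
    have : (0 : ℝ) ≤ (H : ℝ) ^ (2 * k) / r := by positivity
    gcongr
    linarith
  constructor
  · have h1 : (H : ℝ) ^ k ≤ Z := by
      have e1 : 1 ≤ Real.exp (A' * g) := Real.one_le_exp (by positivity)
      have : (0 : ℝ) ≤ (H : ℝ) ^ (2 * k) / r := by positivity
      calc (H : ℝ) ^ k ≤ 1 * ((H : ℝ) ^ k + (H : ℝ) ^ (2 * k) / r) := by linarith
        _ ≤ Z := by rw [hZ]; gcongr
    have hM : (0 : ℝ) < (H : ℝ) ^ (2 * k) := by positivity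
    refine le_of_mul_le_mul_left ?_ hM
    calc (H : ℝ) ^ (2 * k) * Q.card = Q.card * ((H : ℝ) ^ k) ^ 2 * 1 := by
          rw [← pow_mul, mul_comm k 2]; ring
      _ ≤ Q.card * Z ^ 2 * H := by gcongr
      _ ≤ A k * (H : ℝ) ^ (4 * k) * Real.log H := h
      _ = (H : ℝ) ^ (2 * k) * (A k * (H : ℝ) ^ (2 * k) * Real.log H) := by
          rw [show 4 * k = 2 * k + 2 * k by ring, pow_add]; ring
      _ ≤ _ := by gcongr
  · have h1 : Real.exp (A' * g) * ((H : ℝ) ^ (2 * k) / r) ≤ Z := by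
      rw [hZ]
      have : (0 : ℝ) ≤ (H : ℝ) ^ k := by positivity
      gcongr
      linarith
    have hM : (0 : ℝ) < (H : ℝ) ^ (4 * k) / T := by positivity
    refine le_of_mul_le_mul_left ?_ hM
    calc (H : ℝ) ^ (4 * k) / T * (Q.card * Real.exp (2 * A' * g))
        = Q.card * (Real.exp (A' * g) * ((H : ℝ) ^ (2 * k) / r)) ^ 2 * H := by
          rw [mul_pow, div_pow, hr2, ← pow_mul, ← Real.exp_nat_mul]
          rw [show 2 * k * 2 = 4 * k by ring]
          push_cast
          rw [← mul_assoc 2 A' g]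
          field_simp
      _ ≤ Q.card * Z ^ 2 * H := by gcongr
      _ ≤ A k * (H : ℝ) ^ (4 * k) * Real.log H := h
      _ ≤ A' * (H : ℝ) ^ (4 * k) * Real.log H := by gcongr
      _ = _ := by field_simp

lemma eventually_le_div_log_pow {ν : ℕ} (hν : 1 ≤ ν) {A : ℝ} (hA : 0 < A) :
    ∀ᶠ T : ℝ in atTop, ∀ H : ℝ, 16 ≤ H → H ≤ T → ∀ x : ℝ,
      x ≤ A * H ^ (2 * ν) * Real.log H →
      x * Real.exp (2 * A * (Real.log H / Real.log (Real.log H))) ≤ A * T * Real.log H →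
      x ≤ T / Real.log T ^ 3 := by
  have hν' : (0 : ℝ) < ν := by exact_mod_cast hν
  filter_upwards [Real.tendsto_log_atTop.eventually (eventually_mul_pow_le_exp_half A 4),
    Real.tendsto_log_atTop.eventually (eventually_mul_pow_le_exp_div_log A 4
      (c := 2 * A / (4 * ν)) (by positivity)), eventually_ge_atTop 16] with T h1 h2 hT H hH hHT x
      hx1 hx2
  have hT0 : 0 < T := by linarith
  have hH0 : 0 < H := by linarith
  have hlogH : 1 < Real.log H := by
    rw [Real.lt_log_iff_exp_lt hH0]
    have := Real.exp_one_lt_d9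
    linarith
  have hlog : Real.log H ≤ Real.log T := Real.log_le_log hH0 hHT
  set L := Real.log T with hL
  have hL0 : 0 < L := by linarith
  have hTL : Real.exp L = T := Real.exp_log hT0
  rw [le_div_iff₀ (by positivity)]
  rcases le_total (4 * ν * Real.log H) L with h | h
  · have e1 : H ^ (2 * ν) ≤ Real.exp (L / 2) := by
      have e2 : H ^ (2 * ν) = Real.exp ((2 * ν : ℕ) * Real.log H) := by
        rw [Real.exp_nat_mul, Real.exp_log hH0]
      rw [e2]
      gcongr
      push_cast
      linarith
    calc x * L ^ 3 ≤ (A * H ^ (2 * ν) * Real.log H) * L ^ 3 := by gcongr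
      _ ≤ (A * Real.exp (L / 2) * L) * L ^ 3 := by gcongr
      _ = (A * L ^ 4) * Real.exp (L / 2) := by ring
      _ ≤ Real.exp (L / 2) * Real.exp (L / 2) := by gcongr
      _ = T := by rw [← Real.exp_add, add_halves, hTL]
  · have hll : 0 < Real.log (Real.log H) := Real.log_pos hlogH
    have e1 : 2 * A / (4 * ν) * (L / Real.log L) ≤
        2 * A * (Real.log H / Real.log (Real.log H)) := by
      calc 2 * A / (4 * ν) * (L / Real.log L) = 2 * A * (L / (4 * ν) / Real.log L) := by ring
        _ ≤ _ := by
          gcongr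
          rw [div_le_iff₀' (by positivity)]
          exact h
    rcases le_total x 0 with hx | hx
    · exact (mul_nonpos_of_nonpos_of_nonneg hx (by positivity)).trans hT0.le
    · have hAL : 0 < A * L := by positivity
      refine le_of_mul_le_mul_left ?_ hAL
      calc A * L * (x * L ^ 3) = x * (A * L ^ 4) := by ring
        _ ≤ x * Real.exp (2 * A * (Real.log H / Real.log (Real.log H))) := by
          gcongr
          exact h2.trans (Real.exp_le_exp.2 e1)
        _ ≤ A * T * Real.log H := hx2
        _ ≤ A * T * L := by gcongr
        _ = A * L * T := by ring

end

section
open Filter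
open scoped Classical

lemma div_four_mul_log_le_primeCounting {T : ℝ} (hT : 16 ≤ T) :
    T / (4 * Real.log T) ≤ Nat.primeCounting ⌊T⌋₊ := by
  have hlog : 0 < Real.log T := Real.log_pos (by linarith)
  refine le_trans ?_ (Chebyshev.pi_ge' (x := T) (by linarith))
  rw [← div_div, div_le_div_iff_of_pos_right hlog]
  have h2 := Real.log_two_gt_d9
  have h2' := Real.log_two_lt_d9
  have h3 : Real.log (T + 2) = 3 * Real.log 2 + Real.log ((T + 2) / 8) := by
    rw [Real.log_div (by linarith) (by norm_num), show (8 : ℝ) = 2 ^ 3 by norm_num, Real.log_pow]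
    push_cast
    ring
  have h4 := Real.log_le_sub_one_of_pos (show 0 < (T + 2) / 8 by linarith)
  nlinarith

lemma exists_exceptional_primes {ν : ℕ} (hν : 1 ≤ ν) : ∃ A : ℝ, 0 < A ∧ ∀ ε : ℝ, 0 < ε →
    ∀ᶠ T : ℝ in atTop, ∃ B : Finset ℕ, (B.card : ℝ) ≤ ε * Nat.primeCounting ⌊T⌋₊ ∧
      ∀ p : ℕ, p.Prime → (p : ℝ) ≤ T → p ∉ B → T / Real.log T ^ 3 < p ∧
        ∀ k, 1 ≤ k → k ≤ ν → ∀ j : ℕ, 16 ≤ 2 ^ j → 2 * 2 ^ j ≤ p → ∀ s : ZMod p,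
          ((disjointSolutions p k (2 ^ j) s).card : ℝ) ≤
            Real.exp (A * (Real.log (2 ^ j : ℕ) / Real.log (Real.log (2 ^ j : ℕ)))) *
              (((2 ^ j : ℕ) : ℝ) ^ k + ((2 ^ j : ℕ) : ℝ) ^ (2 * k) / √((2 ^ j : ℕ) * T)) := by
  obtain ⟨A, hA, hcard⟩ := exists_card_exceptional_le ν
  refine ⟨A, hA, fun ε hε => ?_⟩
  filter_upwards [eventually_le_div_log_pow hν hA, eventually_ge_atTop 16,
    Real.tendsto_log_atTop.eventually_ge_atTop (4 * (1 + 3 * ν) / ε)] with T hsmall hT hLε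
  have hT0 : 0 < T := by linarith
  have hL1 : 1 < Real.log T := by
    rw [Real.lt_log_iff_exp_lt hT0]
    have := Real.exp_one_lt_d9
    linarith
  set L := Real.log T with hL
  have hL0 : 0 < L := by linarith
  set Q : ℕ × ℕ → Finset ℕ := fun a => (Finset.range (⌊T⌋₊ + 1)).filter fun p : ℕ =>
    p.Prime ∧ 16 ≤ 2 ^ a.1 ∧ 2 * 2 ^ a.1 ≤ p ∧ ∃ s : ZMod p,
      Real.exp (A * (Real.log (2 ^ a.1 : ℕ) / Real.log (Real.log (2 ^ a.1 : ℕ)))) *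
        (((2 ^ a.1 : ℕ) : ℝ) ^ a.2 + ((2 ^ a.1 : ℕ) : ℝ) ^ (2 * a.2) / √((2 ^ a.1 : ℕ) * T)) ≤
        (disjointSolutions p a.2 (2 ^ a.1) s).card with hQ
  set I := Finset.range (⌊2 * L⌋₊ + 1) ×ˢ Finset.Icc 1 ν with hI
  have hQcard : ∀ a ∈ I, ((Q a).card : ℝ) ≤ T / L ^ 3 := by
    rintro ⟨j, k⟩ ha
    rw [hI, Finset.mem_product, Finset.mem_Icc] at ha
    rcases (Q (j, k)).eq_empty_or_nonempty with h | ⟨p, hp⟩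
    · rw [h, Finset.card_empty, Nat.cast_zero]
      positivity
    · simp only [hQ, Finset.mem_filter, Finset.mem_range] at hp
      obtain ⟨hpT, -, h16, h2p, -⟩ := hp
      have h1 := hcard k ha.2.1 ha.2.2 (2 ^ j) h16 T hT0 (Q (j, k))
        (fun p hp => ⟨(Finset.mem_filter.1 hp).2.1, (Finset.mem_filter.1 hp).2.2.2.1⟩)
        (fun p hp => (Finset.mem_filter.1 hp).2.2.2.2)
      refine hsmall (2 ^ j : ℕ) (by exact_mod_cast h16) ?_ _ h1.1 h1.2
      refine le_trans ?_ (Nat.floor_le hT0.le)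
      rw [Nat.cast_le]
      omega
  refine ⟨Finset.Icc 1 ⌊T / L ^ 3⌋₊ ∪ I.biUnion Q, ?_, fun p hp hpT hpB => ?_⟩
  · have h1 : ((I.biUnion Q).card : ℝ) ≤ (2 * L + 1) * ν * (T / L ^ 3) := by
      calc ((I.biUnion Q).card : ℝ) ≤ ∑ a ∈ I, ((Q a).card : ℝ) := by
            exact_mod_cast Finset.card_biUnion_le
        _ ≤ ∑ a ∈ I, T / L ^ 3 := Finset.sum_le_sum hQcard
        _ = (⌊2 * L⌋₊ + 1) * ν * (T / L ^ 3) := by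
          rw [Finset.sum_const, hI, Finset.card_product, Finset.card_range, Nat.card_Icc,
            nsmul_eq_mul, Nat.add_sub_cancel]
          push_cast
          ring
        _ ≤ _ := by
          gcongr
          exact Nat.floor_le (by positivity)
    have h2 : ((Finset.Icc 1 ⌊T / L ^ 3⌋₊).card : ℝ) ≤ T / L ^ 3 := by
      rw [Nat.card_Icc, Nat.add_sub_cancel]
      exact Nat.floor_le (by positivity)
    have h3 : ((Finset.Icc 1 ⌊T / L ^ 3⌋₊ ∪ I.biUnion Q).card : ℝ) ≤
        (Finset.Icc 1 ⌊T / L ^ 3⌋₊).card + (I.biUnion Q).card := by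
      exact_mod_cast Finset.card_union_le _ _
    have h4 : 1 + (2 * L + 1) * ν ≤ ε * L ^ 2 / 4 := by
      rw [div_le_iff₀ hε] at hLε
      have : (0 : ℝ) ≤ ν := Nat.cast_nonneg ν
      nlinarith
    calc _ ≤ T / L ^ 3 * (1 + (2 * L + 1) * ν) := by linarith
      _ ≤ T / L ^ 3 * (ε * L ^ 2 / 4) := by gcongr
      _ = ε * (T / (4 * L)) := by field_simp
      _ ≤ _ := by
        gcongr
        exact div_four_mul_log_le_primeCounting hT
  · rw [Finset.mem_union, not_or, Finset.mem_Icc] at hpB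
    refine ⟨?_, fun k hk hkν j hj hjp s => ?_⟩
    · by_contra h
      exact hpB.1 ⟨hp.one_lt.le, Nat.le_floor (not_lt.1 h)⟩
    · by_contra h
      apply hpB.2
      refine Finset.mem_biUnion.2 ⟨(j, k), ?_, ?_⟩
      · rw [hI, Finset.mem_product, Finset.mem_range, Finset.mem_Icc]
        refine ⟨Nat.lt_succ_of_le (Nat.le_floor ?_), hk, hkν⟩
        have h1 : ((2 : ℝ)) ^ j ≤ T := by
          refine le_trans ?_ hpT
          have : 2 ^ j ≤ p := by omega
          exact_mod_cast this
        have h2 := Real.log_le_log (by positivity) h1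
        rw [Real.log_pow] at h2
        have := Real.log_two_gt_d9
        have : (j : ℝ) * (1 / 2) ≤ j * Real.log 2 := by
          gcongr
          linarith
        linarith
      · rw [hQ, Finset.mem_filter, Finset.mem_range]
        exact ⟨Nat.lt_succ_of_le (Nat.le_floor hpT), hp, hj, hjp, s, (not_le.1 h).le⟩

end

section
open scoped Classical

lemma one_lt_log {x : ℝ} (hx : 3 ≤ x) : 1 < Real.log x := by
  rw [Real.lt_log_iff_exp_lt (by linarith)]
  have := Real.exp_one_lt_d9
  linarith

lemma log_div_log_log_four_mul_le {H h : ℝ} (hH : 16 ≤ H) (hHh : H ≤ h) (hh : h ≤ 4 * H) :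
    Real.log H / Real.log (Real.log H) ≤ 2 * (Real.log h / Real.log (Real.log h)) := by
  have h1 : 2 ≤ Real.log H := by
    rw [Real.le_log_iff_exp_le (by linarith), ← one_add_one_eq_two, Real.exp_add]
    have := Real.exp_one_lt_d9
    have := Real.exp_pos 1
    nlinarith
  have h2 : Real.log H ≤ Real.log h := Real.log_le_log (by linarith) hHh
  have h3 : Real.log h ≤ Real.log H ^ 2 := by
    have e1 : Real.log h ≤ Real.log (H * H) := Real.log_le_log (by linarith) (by nlinarith)
    rw [Real.log_mul (by linarith) (by linarith)] at e1
    nlinarith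
  have h4 : Real.log (Real.log h) ≤ 2 * Real.log (Real.log H) := by
    have := Real.log_le_log (by linarith) h3
    rwa [Real.log_pow, Nat.cast_ofNat] at this
  have h5 : 0 < Real.log (Real.log H) := Real.log_pos (by linarith)
  have h6 : 0 < Real.log (Real.log h) := Real.log_pos (by linarith)
  rw [← mul_div_assoc, div_le_div_iff₀ h5 h6]
  nlinarith

/-- The `ν`-fold product set of `{x + s : 1 ≤ x ≤ h}` in `ZMod p`. -/
def productSet (p ν h : ℕ) (s : ZMod p) : Set (ZMod p) :=
  {z | ∃ g : Fin ν → ℤ, (∀ i, 1 ≤ g i ∧ g i ≤ (h : ℤ)) ∧ z = ∏ i, ((g i : ZMod p) + s)}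

lemma card_image_box_le_ncard_productSet {p ν N h : ℕ} (hp : p.Prime) (hN : N ≤ h) (s : ZMod p) :
    ((box ν N).image fun x => ∏ i, ((x i : ZMod p) + s)).card ≤ (productSet p ν h s).ncard := by
  have := Fact.mk hp
  rw [← Set.ncard_coe_finset]
  refine Set.ncard_le_ncard ?_ (Set.toFinite _)
  intro z hz
  obtain ⟨x, hx, rfl⟩ := Finset.mem_image.1 (Finset.mem_coe.1 hz)
  rw [mem_box] at hx
  refine ⟨fun i => (x i : ℤ), fun i => ?_, ?_⟩
  · have := hx i
    dsimp only
    omega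
  · simp only [Int.cast_natCast]

lemma one_le_ncard_productSet {p ν h : ℕ} (hp : p.Prime) (hh : 1 ≤ h) (s : ZMod p) :
    1 ≤ (productSet p ν h s).ncard := by
  refine le_trans ?_ (card_image_box_le_ncard_productSet hp hh s)
  refine Finset.card_pos.2 (Finset.Nonempty.image ?_ _)
  exact ⟨fun _ => 1, mem_box.2 fun _ => ⟨le_rfl, le_rfl⟩⟩

lemma ncard_productSet_of_le {p ν h : ℕ} (hν : 1 ≤ ν) (hp : p.Prime) (hh : p ≤ h) (s : ZMod p) :
    (productSet p ν h s).ncard = p := by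
  have := Fact.mk hp
  have hrep : ∀ w : ZMod p, ∃ a : ℤ, (1 ≤ a ∧ a ≤ h) ∧ (a : ZMod p) + s = w := by
    intro w
    have h1 := ZMod.natCast_zmod_val (w - s)
    have h2 := ZMod.val_lt (w - s)
    rcases Nat.eq_zero_or_pos (w - s).val with h0 | h0
    · have := hp.one_lt
      refine ⟨p, by omega, ?_⟩
      rw [h0, Nat.cast_zero] at h1
      rw [Int.cast_natCast, ZMod.natCast_self, h1, sub_add_cancel]
    · refine ⟨(w - s).val, by omega, ?_⟩
      rw [Int.cast_natCast, h1, sub_add_cancel]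
  choose a ha using hrep
  have huniv : productSet p ν h s = Set.univ := by
    refine Set.eq_univ_of_forall fun z => ?_
    refine ⟨fun i => a (if i = ⟨0, hν⟩ then z else 1), fun i => (ha _).1, ?_⟩
    simp only [(ha _).2, Finset.prod_ite_eq', Finset.mem_univ, if_true]
  rw [huniv, Set.ncard_univ, Nat.card_zmod]

lemma exists_min_le_of_lt_prime (ν : ℕ) {A : ℝ} (hA : 0 < A) : ∃ C : ℝ, 0 < C ∧
    ∀ (p : ℕ) (T : ℝ), p.Prime → 0 < T →
      (∀ k, 1 ≤ k → k ≤ ν → ∀ j : ℕ, 16 ≤ 2 ^ j → 2 * 2 ^ j ≤ p → ∀ s : ZMod p,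
          ((disjointSolutions p k (2 ^ j) s).card : ℝ) ≤
            Real.exp (A * (Real.log (2 ^ j : ℕ) / Real.log (Real.log (2 ^ j : ℕ)))) *
              (((2 ^ j : ℕ) : ℝ) ^ k + ((2 ^ j : ℕ) : ℝ) ^ (2 * k) / √((2 ^ j : ℕ) * T))) →
      ∀ h : ℕ, 64 ≤ h → h < p → ∀ s : ZMod p, min ((h : ℝ) ^ ν) (√(h * T)) ≤
        Real.exp (C * (Real.log h / Real.log (Real.log h))) * (productSet p ν h s).ncard := by
  obtain ⟨c, hc, hmain⟩ := exists_le_card_image_box ν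
  set c' : ℝ := 4 ^ (ν + 1) / c with hc'
  have hc'0 : 0 < c' := by positivity
  refine ⟨c' + 2 * A, by positivity, fun p T hp hT hsol h hh hhp s => ?_⟩
  obtain ⟨m, hm1, hm2⟩ : ∃ m : ℕ, 2 * 2 ^ m ≤ h ∧ h < 4 * 2 ^ m := by
    have h1 := Nat.pow_log_le_self 2 (show h ≠ 0 by omega)
    have h2 := Nat.lt_pow_succ_log_self one_lt_two h
    have h3 : 0 < Nat.log 2 h := Nat.log_pos one_lt_two (by omega)
    obtain ⟨m, hm⟩ := Nat.exists_eq_succ_of_ne_zero h3.ne'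
    rw [hm] at h1 h2
    refine ⟨m, ?_, ?_⟩
    · rw [Nat.succ_eq_add_one, pow_succ] at h1
      omega
    · rw [Nat.succ_eq_add_one, pow_succ, pow_succ] at h2
      omega
  have hm16 : 16 ≤ 2 ^ m := by omega
  have hsol' := fun k h1 h2 => hsol k h1 h2 m hm16 (by omega) s
  set H := 2 ^ m
  have hH16 : (16 : ℝ) ≤ H := by exact_mod_cast hm16
  have hHh : (H : ℝ) ≤ h := by
    have : H ≤ h := by omega
    exact_mod_cast this
  have hh4 : (h : ℝ) ≤ 4 * H := by exact_mod_cast hm2.le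
  have hg := log_div_log_log_four_mul_le hH16 hHh hh4
  have hg1 := one_le_log_div_log_log (hH16.trans hHh)
  have hg0 := one_le_log_div_log_log hH16
  have hH0 : (0 : ℝ) < H := by linarith
  have h1 := hmain p H hp (by omega) (by omega) s _ (√(H * T))
    (Real.one_le_exp (by positivity)) (by positivity) hsol'
  have h2 : (((box ν H).image fun x => ∏ i, ((x i : ZMod p) + s)).card : ℝ) ≤
      (productSet p ν h s).ncard := by
    exact_mod_cast card_image_box_le_ncard_productSet hp (by omega) s
  have h3 : min ((h : ℝ) ^ ν) (√(h * T)) ≤ 4 ^ (ν + 1) * min ((H : ℝ) ^ ν) (√(H * T)) := by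
    rw [mul_min_of_nonneg _ _ (by positivity)]
    refine min_le_min ?_ ?_
    · calc (h : ℝ) ^ ν ≤ (4 * H) ^ ν := by gcongr
        _ = 4 ^ ν * (H : ℝ) ^ ν := mul_pow _ _ _
        _ ≤ _ := by
          gcongr
          · norm_num
          · omega
    · calc √(h * T) ≤ √(4 ^ 2 * (H * T)) := by
            apply Real.sqrt_le_sqrt
            have : 0 < (H : ℝ) * T := by positivity
            nlinarith
        _ = 4 * √(H * T) := by
          rw [Real.sqrt_mul (by positivity), Real.sqrt_sq (by norm_num)]
        _ ≤ _ := by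
          gcongr
          exact le_self_pow₀ (by norm_num) (by omega)
  set g := Real.log h / Real.log (Real.log h)
  set g₀ := Real.log H / Real.log (Real.log H)
  have h4 : c' ≤ Real.exp (c' * g) := by
    have e1 := Real.add_one_le_exp (c' * g)
    nlinarith
  have h5 : min ((H : ℝ) ^ ν) (√(H * T)) ≤
      Real.exp (A * g₀) * (productSet p ν h s).ncard / c := by
    rw [le_div_iff₀' hc]
    exact h1.trans (by gcongr)
  calc _ ≤ 4 ^ (ν + 1) * (Real.exp (A * g₀) * (productSet p ν h s).ncard / c) := by
        refine h3.trans ?_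
        gcongr
    _ = c' * Real.exp (A * g₀) * (productSet p ν h s).ncard := by rw [hc']; ring
    _ ≤ Real.exp (c' * g) * Real.exp (A * (2 * g)) * (productSet p ν h s).ncard := by gcongr
    _ = _ := by
      rw [← Real.exp_add]
      congr 2
      ring

lemma pow_le_exp_of_lt {ν h : ℕ} (hh : 3 ≤ h) (hh' : h < 64) {C : ℝ} (hC : 2 * ν ≤ C) :
    (h : ℝ) ^ ν ≤ Real.exp (C * (Real.log h / Real.log (Real.log h))) := by
  have hh3 : (3 : ℝ) ≤ h := by exact_mod_cast hh
  have h1 := one_lt_log hh3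
  have h2 : 0 < Real.log (Real.log h) := Real.log_pos h1
  have h3 : Real.log h ≤ 5 := by
    have e1 : Real.log h ≤ Real.log (2 ^ 6) := by
      apply Real.log_le_log (by linarith)
      have : (h : ℝ) < 64 := by exact_mod_cast hh'
      linarith
    rw [Real.log_pow] at e1
    have := Real.log_two_lt_d9
    push_cast at e1
    linarith
  have h4 : Real.log (Real.log h) ≤ 2 := by
    rw [Real.log_le_iff_le_exp (by linarith), ← one_add_one_eq_two, Real.exp_add]
    have := Real.exp_one_gt_d9
    nlinarith
  have h5 : Real.log h ≤ 2 * (Real.log h / Real.log (Real.log h)) := by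
    rw [← mul_div_assoc, le_div_iff₀ h2]
    nlinarith
  calc (h : ℝ) ^ ν = Real.exp (ν * Real.log h) := by
        rw [Real.exp_nat_mul, Real.exp_log (by linarith)]
    _ ≤ Real.exp (ν * (2 * (Real.log h / Real.log (Real.log h)))) := by gcongr
    _ = Real.exp (2 * ν * (Real.log h / Real.log (Real.log h))) := by
        congr 1
        ring
    _ ≤ _ := by gcongr

lemma eventually_le_exp_mul :
    ∀ᶠ T : ℝ in Filter.atTop, ∀ p h : ℝ, T / Real.log T ^ 3 < p → p ≤ h → h < T →
      ∀ C : ℝ, 1 ≤ C → √(h * T) ≤ Real.exp (C * (Real.log h / Real.log (Real.log h))) * p := by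
  filter_upwards [Real.tendsto_log_atTop.eventually (eventually_mul_pow_le_exp_half 1 3),
    Real.tendsto_log_atTop.eventually (eventually_mul_pow_le_exp_div_log 1 3 one_half_pos),
    Filter.eventually_ge_atTop 9] with T h1 h2 hT p h hTp hph hhT C hC
  have hT0 : 0 < T := by linarith
  have hL1 := one_lt_log (show 3 ≤ T by linarith)
  set L := Real.log T with hL
  have hL0 : 0 < L := by linarith
  rw [one_mul] at h1 h2
  have hTL : Real.exp L = T := Real.exp_log hT0
  have hlow : Real.exp (L / 2) < h := by
    refine lt_of_le_of_lt ?_ (hTp.trans_le hph)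
    rw [le_div_iff₀ (by positivity)]
    calc Real.exp (L / 2) * L ^ 3 ≤ Real.exp (L / 2) * Real.exp (L / 2) := by gcongr
      _ = T := by rw [← Real.exp_add, add_halves, hTL]
  have hp0 : 0 < p := lt_trans (by positivity) hTp
  have hh0 : 0 < h := hp0.trans_le hph
  have hlogh : L / 2 ≤ Real.log h := ((Real.lt_log_iff_exp_lt hh0).2 hlow).le
  have hlogh' : Real.log h ≤ L := Real.log_le_log hh0 hhT.le
  have hlog1 : 1 < Real.log h := by
    apply one_lt_log
    have e1 : (3 : ℝ) = Real.exp (Real.log 9 / 2) := by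
      rw [show (9 : ℝ) = 3 ^ 2 by norm_num, Real.log_pow, Nat.cast_ofNat,
        mul_div_cancel_left₀ _ two_ne_zero, Real.exp_log (by norm_num)]
    have e2 : Real.log 9 ≤ L := Real.log_le_log (by norm_num) hT
    rw [e1]
    refine le_trans ?_ hlow.le
    gcongr
  have hll : 0 < Real.log (Real.log h) := Real.log_pos hlog1
  have hlogL : 0 < Real.log L := Real.log_pos hL1
  have hexp : L ^ 3 ≤ Real.exp (C * (Real.log h / Real.log (Real.log h))) := by
    refine h2.trans (Real.exp_le_exp.2 ?_)
    calc 1 / 2 * (L / Real.log L) = 1 * (L / 2 / Real.log L) := by ring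
      _ ≤ _ := by gcongr
  have hsqrt : √(h * T) ≤ T := by
    rw [Real.sqrt_le_left hT0.le]
    nlinarith
  rw [div_lt_iff₀ (by positivity)] at hTp
  calc √(h * T) ≤ p * L ^ 3 := hsqrt.trans hTp.le
    _ ≤ p * Real.exp (C * (Real.log h / Real.log (Real.log h))) := by gcongr
    _ = _ := mul_comm _ _

end

/-- For fixed `ν ≥ 1`, there is `C > 0` such that for every `ε > 0` there is `T₀`
so that for all `T ≥ T₀`, for all but at most `ε·π(T)` primes `p ≤ T`: for every integer
`3 ≤ h < T` and every `s ∈ 𝔽_p`, the `ν`-fold product set of `A = {x + s : 1 ≤ x ≤ h}`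
has at least `min(h^ν, (hT)^{1/2}) exp(-C log h / log log h)` elements. -/
theorem stmt1 (ν : ℕ) (hν : 1 ≤ ν) :
    ∃ C : ℝ, 0 < C ∧ ∀ ε : ℝ, 0 < ε → ∃ T₀ : ℝ, ∀ T : ℝ, T₀ ≤ T →
      (Set.ncard {p : ℕ | p.Prime ∧ (p : ℝ) ≤ T ∧
        ¬ (∀ h : ℕ, 3 ≤ h → (h : ℝ) < T → ∀ s : ZMod p,
            (Set.ncard {z : ZMod p | ∃ g : Fin ν → ℤ,
                (∀ i, 1 ≤ g i ∧ g i ≤ (h : ℤ)) ∧ z = ∏ i, ((g i : ZMod p) + s)} : ℝ) ≥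
              min ((h : ℝ) ^ ν) (((h : ℝ) * T) ^ ((1 : ℝ) / 2)) *
                Real.exp (-(C * Real.log h / Real.log (Real.log h))))} : ℝ)
      ≤ ε * (Set.ncard {p : ℕ | p.Prime ∧ (p : ℝ) ≤ T} : ℝ) := by
  obtain ⟨A, hA, hexc⟩ := exists_exceptional_primes hν
  obtain ⟨C₀, hC₀, hmid⟩ := exists_min_le_of_lt_prime ν hA
  refine ⟨C₀ + 2 * ν + 1, by positivity, fun ε hε => ?_⟩
  obtain ⟨T₀, hT₀⟩ := Filter.eventually_atTop.1 ((hexc ε hε).and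
    (eventually_le_exp_mul.and (Filter.eventually_gt_atTop 0)))
  refine ⟨T₀, fun T hT => ?_⟩
  obtain ⟨⟨B, hBcard, hB⟩, hlarge, hTpos⟩ := hT₀ T hT
  have hpi : Set.ncard {p : ℕ | p.Prime ∧ (p : ℝ) ≤ T} = Nat.primeCounting ⌊T⌋₊ := by
    rw [Nat.primeCounting, Nat.primeCounting', Nat.count_eq_card_filter_range,
      ← Set.ncard_coe_finset]
    congr 1
    ext p
    rw [Finset.mem_coe, Finset.mem_filter, Finset.mem_range, Nat.lt_succ_iff,
      Nat.le_floor_iff hTpos.le, Set.mem_ofPred_eq, and_comm]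
  rw [hpi]
  refine le_trans ?_ hBcard
  rw [Nat.cast_le, ← Set.ncard_coe_finset B]
  refine Set.ncard_le_ncard ?_ B.finite_toSet
  rintro p ⟨hp, hpT, hbad⟩
  by_contra hpB
  obtain ⟨hplow, hsol⟩ := hB p hp hpT fun h => hpB (Finset.mem_coe.2 h)
  refine hbad fun h hh hhT s => ?_
  change ((productSet p ν h s).ncard : ℝ) ≥ _
  rw [← Real.sqrt_eq_rpow, mul_div_assoc, Real.exp_neg, ← div_eq_mul_inv, ge_iff_le,
    div_le_iff₀' (Real.exp_pos _)]
  have hh3 : (3 : ℝ) ≤ h := by exact_mod_cast hh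
  have hg : 0 ≤ Real.log h / Real.log (Real.log h) := by
    have h1 := one_lt_log hh3
    exact div_nonneg (by linarith) (Real.log_pos h1).le
  rcases lt_or_ge h 64 with h64 | h64
  · have h1 : (1 : ℝ) ≤ (productSet p ν h s).ncard := by
      exact_mod_cast one_le_ncard_productSet hp (by omega) s
    refine (min_le_left _ _).trans ((pow_le_exp_of_lt hh h64
      (show 2 * (ν : ℝ) ≤ C₀ + 2 * ν + 1 by linarith)).trans ?_)
    exact le_mul_of_one_le_right (Real.exp_pos _).le h1
  rcases lt_or_ge h p with hhp | hhp
  · refine (hmid p T hp hTpos hsol h h64 hhp s).trans ?_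
    gcongr
    have : (0 : ℝ) ≤ ν := Nat.cast_nonneg ν
    linarith
  · rw [ncard_productSet_of_le hν hp hhp s]
    refine (min_le_right _ _).trans (hlarge p h hplow (by exact_mod_cast hhp) hhT _ ?_)
    have : (0 : ℝ) ≤ ν := Nat.cast_nonneg ν
    linarith
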